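/- arXiv:2012.07256 — 7 statements merged into one kernel-verified Lean document; each statement's English description precedes it below -/
import Mathlib

section
/- For every parameter μ ∈ (0,1], the Borel probabilities sum to one: Σ_{n≥1} e^{−μn} (μn)^{n−1} / n! = 1. -/
open Finset in
/-- The finite-difference identity cancelling the coefficient of `μ ^ k` in the Borel series. -/
lemma sum_borel_coeff_mul_neg_pow {k : ℕ} (hk : k ≠ 0) :
    ∑ n ∈ range (k + 1), ((n + 1 : ℝ) ^ n / (n + 1).factorial) *
      ((-(n + 1 : ℝ)) ^ (k - n) / (k - n).factorial) = 0 := by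
  have h := congrFun (fwdDiff_iter_pow_eq_zero_of_lt (R := ℝ) (lt_add_one k)) 0
  rw [fwdDiff_iter_eq_sum_shift, sum_range_succ'] at h
  simp only [zsmul_eq_mul, nsmul_eq_mul, mul_one, zero_add, Nat.cast_zero, Pi.zero_apply,
    zero_pow hk, mul_zero, add_zero, Int.cast_mul, Int.cast_pow, Int.cast_neg, Int.cast_one,
    Int.cast_natCast, Nat.add_sub_add_right] at h
  have h2 : ((k + 1).factorial : ℝ) ≠ 0 := by positivity
  rw [← mul_right_inj' h2, mul_zero, ← h, mul_sum]
  refine sum_congr rfl fun n hn ↦ ?_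
  have hnk : n ≤ k := Nat.lt_succ_iff.1 (mem_range.1 hn)
  rw [Nat.cast_choose ℝ (by omega : n + 1 ≤ k + 1), Nat.add_sub_add_right, neg_pow (n + 1 : ℝ)]
  obtain ⟨j, rfl⟩ := Nat.exists_eq_add_of_le hnk
  simp only [Nat.add_sub_cancel_left, Nat.cast_add, Nat.cast_one, pow_add]
  field_simp

lemma borel_coeff_le_exp (n : ℕ) :
    (n + 1 : ℝ) ^ n / (n + 1).factorial ≤ Real.exp 1 * Real.exp 1 ^ n := by
  have h := Real.pow_div_factorial_le_exp (x := (n + 1 : ℝ)) (by positivity) (n + 1)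
  have h3 : Real.exp (n + 1 : ℝ) = Real.exp 1 * Real.exp 1 ^ n := by
    rw [← Real.exp_nat_mul, ← Real.exp_add]; ring_nf
  rw [← h3]
  refine le_trans ?_ h
  gcongr
  · simp
  · omega

lemma borel_term_eq (μ : ℝ) (n : ℕ) :
    Real.exp (-μ * (n + 1)) * (μ * (n + 1)) ^ n / (n + 1).factorial =
      Real.exp (-μ) * (((n + 1 : ℝ) ^ n / (n + 1).factorial) * (μ * Real.exp (-μ)) ^ n) := by
  have : Real.exp (-μ * (n + 1)) = Real.exp (-μ) * Real.exp (-μ) ^ n := by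
    rw [← Real.exp_nat_mul, ← Real.exp_add]; ring_nf
  rw [this, mul_pow, mul_pow]
  ring

lemma mul_exp_neg_lt_exp_neg_one {μ : ℝ} (hμ : μ ≠ 1) :
    μ * Real.exp (-μ) < Real.exp (-1) := by
  have h := Real.add_one_lt_exp (sub_ne_zero.2 hμ)
  have h2 : Real.exp (-1) = Real.exp (μ - 1) * Real.exp (-μ) := by
    rw [← Real.exp_add]; ring_nf
  rw [h2]
  have := Real.exp_pos (-μ)
  gcongr
  linarith

lemma summable_borel_coeff_mul_pow {x : ℝ} (hx0 : 0 ≤ x) (hx : x < Real.exp (-1)) :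
    Summable fun n : ℕ ↦ ((n + 1 : ℝ) ^ n / (n + 1).factorial) * x ^ n := by
  have h1 : Real.exp 1 * x < 1 := by
    rwa [Real.exp_neg, ← one_div, lt_div_iff₀' (Real.exp_pos 1)] at hx
  refine Summable.of_nonneg_of_le (fun n ↦ by positivity) (fun n ↦ ?_)
    ((summable_geometric_of_lt_one (by positivity) h1).mul_left (Real.exp 1))
  rw [mul_pow, ← mul_assoc]
  gcongr
  exact borel_coeff_le_exp n

open Finset in
lemma tsum_borel_of_lt {μ : ℝ} (hμ0 : 0 < μ) (hμ1 : μ < 1 / 8) :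
    ∑' n : ℕ, Real.exp (-μ * (n + 1)) * (μ * (n + 1)) ^ n / (n + 1).factorial = 1 := by
  set F : ℕ × ℕ → ℝ := fun p ↦ ((p.1 + 1 : ℝ) ^ p.1 / (p.1 + 1).factorial) * μ ^ p.1 *
    ((-μ * (p.1 + 1)) ^ p.2 / p.2.factorial) with hF
  have hexp (x : ℝ) : HasSum (fun j : ℕ ↦ x ^ j / j.factorial) (Real.exp x) := by
    rw [Real.exp_eq_exp_ℝ]; exact NormedSpace.expSeries_div_hasSum_exp x
  have hnorm (p : ℕ × ℕ) : ‖F p‖ = ((p.1 + 1 : ℝ) ^ p.1 / (p.1 + 1).factorial) * μ ^ p.1 *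
      ((μ * (p.1 + 1)) ^ p.2 / p.2.factorial) := by
    have h1 : |(p.1 + 1 : ℝ)| = p.1 + 1 := abs_of_nonneg (by positivity)
    simp only [hF, norm_mul, norm_div, norm_pow, Real.norm_eq_abs, abs_neg, Nat.abs_cast, h1,
      abs_of_pos hμ0]
  have hsmall : μ * Real.exp μ < Real.exp (-1) := by
    have h1 : Real.exp μ < Real.exp 1 := Real.exp_lt_exp.2 (by linarith)
    have h2 := Real.exp_one_lt_d9
    have h3 : (1 / 2.7182818286 : ℝ) < Real.exp (-1) := by
      rw [Real.exp_neg, ← one_div]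
      exact one_div_lt_one_div_of_lt (Real.exp_pos 1) h2
    have h4 : μ * Real.exp μ ≤ 1 / 8 * 2.7182818286 := by
      gcongr
      linarith
    norm_num at h3 h4 ⊢
    linarith
  have hsum : Summable F := by
    refine Summable.of_norm ?_
    rw [summable_prod_of_nonneg (fun p ↦ norm_nonneg _)]
    simp only [hnorm]
    refine ⟨fun n ↦ (hexp _).summable.mul_left _, ?_⟩
    simp only [tsum_mul_left, (hexp _).tsum_eq]
    refine ((summable_borel_coeff_mul_pow (by positivity) hsmall).mul_left
      (Real.exp μ)).congr fun n ↦ ?_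
    have : Real.exp (μ * (n + 1)) = Real.exp μ * Real.exp μ ^ n := by
      rw [← Real.exp_nat_mul, ← Real.exp_add]; ring_nf
    rw [this, mul_pow]
    ring
  have hdiag (k : ℕ) : ∑ p ∈ antidiagonal k, F p = if k = 0 then 1 else 0 := by
    rw [Finset.Nat.sum_antidiagonal_eq_sum_range_succ_mk]
    split_ifs with hk
    · subst hk; simp [hF]
    · rw [← mul_zero (μ ^ k), ← sum_borel_coeff_mul_neg_pow hk, mul_sum]
      refine sum_congr rfl fun n hn ↦ ?_
      obtain ⟨j, rfl⟩ := Nat.exists_eq_add_of_le (Nat.lt_succ_iff.1 (mem_range.1 hn))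
      simp only [hF, Nat.add_sub_cancel_left]
      rw [neg_mul_comm, mul_pow μ, pow_add]
      ring
  calc _ = ∑' n : ℕ, ∑' j : ℕ, F (n, j) := by
        refine tsum_congr fun n ↦ ?_
        simp only [hF, tsum_mul_left, (hexp _).tsum_eq]
        rw [mul_pow]
        ring
    _ = ∑' p, F p := hsum.tsum_prod.symm
    _ = ∑' k : ℕ, ∑ p ∈ antidiagonal k, F p := by
        have h := HasAntidiagonal.sigmaAntidiagonalEquivProd.summable_iff.2 hsum
        rw [← HasAntidiagonal.sigmaAntidiagonalEquivProd.tsum_eq]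
        refine h.tsum_sigma.trans ?_
        refine tsum_congr fun k ↦ ?_
        rw [tsum_fintype, ← sum_coe_sort (antidiagonal k)]
        rfl
    _ = 1 := by simp [hdiag]

open Set in
lemma tsum_borel_of_lt_one {μ : ℝ} (hμ0 : 0 < μ) (hμ1 : μ < 1) :
    ∑' n : ℕ, Real.exp (-μ * (n + 1)) * (μ * (n + 1)) ^ n / (n + 1).factorial = 1 := by
  set c : ℕ → ℝ := fun n ↦ (n + 1 : ℝ) ^ n / (n + 1).factorial
  set p := FormalMultilinearSeries.ofScalars ℝ c with hp
  have hr : (NNReal.mk (Real.exp (-1)) (Real.exp_pos _).le : ENNReal) ≤ p.radius := by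
    refine p.le_radius_of_bound (Real.exp 1) fun n ↦ ?_
    rw [hp, FormalMultilinearSeries.ofScalars_norm, Real.norm_of_nonneg (by positivity)]
    calc c n * Real.exp (-1) ^ n ≤ Real.exp 1 * Real.exp 1 ^ n * Real.exp (-1) ^ n := by
          gcongr; exact borel_coeff_le_exp n
      _ = Real.exp 1 := by rw [mul_assoc, ← mul_pow, ← Real.exp_add]; simp
  have hf (x : ℝ) : Real.exp (-x) * p.sum (x * Real.exp (-x)) =
      ∑' n : ℕ, Real.exp (-x * (n + 1)) * (x * (n + 1)) ^ n / (n + 1).factorial := by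
    simp only [borel_term_eq, tsum_mul_left]
    congr 1
    exact FormalMultilinearSeries.ofScalars_sum_eq c _
  have han : AnalyticOnNhd ℝ (fun x : ℝ ↦ Real.exp (-x) * p.sum (x * Real.exp (-x)))
      (Ioo 0 1) := by
    intro x hx
    have he : AnalyticAt ℝ (fun x : ℝ ↦ Real.exp (-x)) x := by fun_prop
    refine he.mul (AnalyticAt.fun_comp (p.analyticOnNhd _ ?_) (analyticAt_id.mul he))
    refine Metric.eball_subset_eball hr ?_
    rw [Metric.eball_coe, mem_ball_zero_iff]
    change ‖x * Real.exp (-x)‖ < _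
    rw [Real.norm_of_nonneg (mul_nonneg hx.1.le (Real.exp_pos _).le)]
    exact mul_exp_neg_lt_exp_neg_one hx.2.ne
  have := han.eqOn_of_preconnected_of_eventuallyEq (g := fun _ ↦ 1) analyticOnNhd_const
    isPreconnected_Ioo (z₀ := 1 / 16) (by norm_num) (by
      filter_upwards [Ioo_mem_nhds (by norm_num : (0 : ℝ) < 1 / 16)
        (by norm_num : (1 / 16 : ℝ) < 1 / 8)] with x hx
      rw [hf, tsum_borel_of_lt hx.1 hx.2]) ⟨hμ0, hμ1⟩
  rwa [← hf]

open Set Topology Filter in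
lemma tsum_borel_one :
    ∑' n : ℕ, Real.exp (-1 * (n + 1)) * (1 * (n + 1)) ^ n / (n + 1).factorial = (1 : ℝ) := by
  set f : ℝ → ℕ → ℝ := fun μ n ↦
    Real.exp (-μ * (n + 1)) * (μ * (n + 1)) ^ n / (n + 1).factorial with hf
  have hcont (n : ℕ) : Tendsto (fun μ ↦ f μ n) (𝓝[<] 1) (𝓝 (f 1 n)) := by
    have : Continuous fun μ ↦ f μ n := by simp only [hf]; fun_prop
    exact this.continuousAt.tendsto.mono_left nhdsWithin_le_nhds
  have hmem : ∀ᶠ μ : ℝ in 𝓝[<] 1, μ ∈ Ioo 0 1 := Ioo_mem_nhdsLT one_pos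
  have hnn {μ : ℝ} (hμ : 0 < μ) (n : ℕ) : 0 ≤ f μ n := by simp only [hf]; positivity
  have hsum : Summable (f 1) := by
    refine summable_of_sum_range_le (hnn one_pos) (c := 1) fun N ↦ ?_
    refine le_of_tendsto (tendsto_finsetSum (Finset.range N) fun n _ ↦ hcont n) ?_
    filter_upwards [hmem] with μ hμ
    have hs : Summable (f μ) := by
      simp only [hf, borel_term_eq]
      exact (summable_borel_coeff_mul_pow (mul_nonneg hμ.1.le (Real.exp_pos _).le)
        (mul_exp_neg_lt_exp_neg_one hμ.2.ne)).mul_left _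
    exact (hs.sum_le_tsum _ fun n _ ↦ hnn hμ.1 n).trans_eq (tsum_borel_of_lt_one hμ.1 hμ.2)
  have hlim : Tendsto (fun μ ↦ ∑' n, f μ n) (𝓝[<] 1) (𝓝 (∑' n, f 1 n)) := by
    refine tendsto_tsum_of_dominated_convergence (hsum.mul_left (Real.exp 1)) hcont ?_
    filter_upwards [hmem] with μ hμ n
    rw [Real.norm_of_nonneg (hnn hμ.1 n)]
    simp only [hf, borel_term_eq]
    rw [← mul_assoc (Real.exp 1), ← Real.exp_add, add_neg_cancel, Real.exp_zero]
    have h1 : Real.exp (-μ) ≤ 1 := Real.exp_le_one_iff.2 (by linarith [hμ.1])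
    have h2 := (mul_exp_neg_lt_exp_neg_one hμ.2.ne).le
    have h3 : 0 ≤ μ := hμ.1.le
    rw [one_mul (Real.exp (-1))]
    gcongr
  refine tendsto_nhds_unique hlim (tendsto_const_nhds.congr' ?_)
  filter_upwards [hmem] with μ hμ
  exact (tsum_borel_of_lt_one hμ.1 hμ.2).symm


/-- For every parameter `μ ∈ (0,1]`, the Borel probabilities
`P(X = n) = e^{-μn} (μn)^{n-1} / n!`, `n ≥ 1`, sum to one.
(The index `n : ℕ` below stands for `n + 1 ≥ 1`.) -/
theorem borel_probabilities_sum_to_one (μ : ℝ) (hμ0 : 0 < μ) (hμ1 : μ ≤ 1) :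
    ∑' n : ℕ, Real.exp (-μ * (n + 1)) * (μ * (n + 1)) ^ n / (n + 1).factorial = 1 := by
  obtain rfl | h := eq_or_lt_of_le hμ1
  · exact tsum_borel_one
  · exact tsum_borel_of_lt_one hμ0 h
end

section
/- Let X be Borel distributed with parameter μ ∈ (0,1) and let G_X(s) = Σ_{n≥1} s^n e^{−μn}(μn)^{n−1}/n! be its probability generating function. Then for every s ∈ [−1,1], G_X satisfies the functional equation G_X(s) = s · e^{μ(G_X(s) − 1)}. -/
open Finset in
/-- The alternating binomial sum of `m`-th powers which computes the coefficients of the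
composition of the tree function with `t ↦ t * exp (-t)`. -/
lemma sum_choose_succ_mul_succ_pow {m : ℕ} (hm : m ≠ 0) :
    ∑ n ∈ range (m + 1), (-1 : ℝ) ^ (m - n) * (m + 1).choose (n + 1) * ((n : ℝ) + 1) ^ m = 0 := by
  have h := congrFun (fwdDiff_iter_pow_eq_zero_of_lt (R := ℝ) (Nat.lt_succ_self m)) 0
  rw [fwdDiff_iter_eq_sum_shift, sum_range_succ'] at h
  simpa [hm] using h

/-- The coefficients `(n + 1) ^ n / (n + 1)!`, so that `x * ∑ treeCoeff n * x ^ n` is the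
exponential generating function of rooted labelled trees. -/
noncomputable def treeCoeff (n : ℕ) : ℝ := ((n : ℝ) + 1) ^ n / (n + 1).factorial

lemma treeCoeff_nonneg (n : ℕ) : 0 ≤ treeCoeff n := by
  unfold treeCoeff; positivity

lemma treeCoeff_le (n : ℕ) : treeCoeff n ≤ Real.exp (n + 1) := by
  refine le_trans ?_ (Real.pow_div_factorial_le_exp (x := (n : ℝ) + 1) (by positivity) (n + 1))
  unfold treeCoeff
  gcongr
  · simp
  · simp

/-- The power series with coefficients `treeCoeff`. -/
noncomputable def treeSeries (x : ℝ) : ℝ := ∑' n, treeCoeff n * x ^ n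

open Finset in
lemma sum_antidiagonal_treeCoeff_mul (m : ℕ) :
    ∑ p ∈ antidiagonal m, treeCoeff p.1 * ((-((p.1 : ℝ) + 1)) ^ p.2 / p.2.factorial) =
      if m = 0 then 1 else 0 := by
  split_ifs with hm
  · subst hm; simp [treeCoeff]
  rw [Nat.sum_antidiagonal_eq_sum_range_succ
    (fun n k => treeCoeff n * ((-((n : ℝ) + 1)) ^ k / k.factorial))]
  rw [← zero_div ((m + 1).factorial : ℝ), ← sum_choose_succ_mul_succ_pow hm, sum_div]
  refine sum_congr rfl fun n hn => ?_
  obtain ⟨k, rfl⟩ := Nat.exists_eq_add_of_le (Nat.lt_succ_iff.mp (mem_range.mp hn))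
  rw [Nat.add_sub_cancel_left, Nat.cast_choose ℝ (by lia : n + 1 ≤ n + k + 1),
    show n + k + 1 - (n + 1) = k by lia, neg_pow, pow_add, treeCoeff]
  have := (n + k + 1).factorial_pos
  field_simp

/-- The substitution `x = t * exp (-t)` in the tree function, near `0`. -/
lemma treeSeries_mul_exp_neg {t : ℝ} (ht0 : 0 ≤ t) (ht : Real.exp (1 + t) * t < 1) :
    treeSeries (t * Real.exp (-t)) = Real.exp t := by
  let f : ℕ × ℕ → ℝ := fun p =>
    treeCoeff p.1 * t ^ p.1 * ((-((p.1 : ℝ) + 1) * t) ^ p.2 / p.2.factorial)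
  have hexp (y : ℝ) : HasSum (fun k : ℕ => y ^ k / k.factorial) (Real.exp y) := by
    rw [Real.exp_eq_exp_ℝ]
    exact NormedSpace.expSeries_div_hasSum_exp y
  have hnorm (n : ℕ) : HasSum (fun k => ‖f (n, k)‖)
      (treeCoeff n * t ^ n * Real.exp (((n : ℝ) + 1) * t)) := by
    refine ((hexp (((n : ℝ) + 1) * t)).mul_left (treeCoeff n * t ^ n)).congr_fun fun k => ?_
    simp only [f, norm_mul, norm_div, norm_pow, norm_neg, Real.norm_eq_abs, Nat.abs_cast,
      abs_of_nonneg (treeCoeff_nonneg n), abs_of_nonneg ht0,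
      abs_of_nonneg (by positivity : (0 : ℝ) ≤ n + 1)]
  have hf : Summable f := by
    refine Summable.of_norm ((summable_prod_of_nonneg fun _ => norm_nonneg _).2
      ⟨fun n => (hnorm n).summable, ?_⟩)
    simp only [(hnorm _).tsum_eq]
    refine Summable.of_nonneg_of_le
      (fun n => by have := treeCoeff_nonneg n; positivity) (fun n => ?_)
      ((summable_geometric_of_lt_one (by positivity) ht).mul_left (Real.exp (1 + t)))
    calc treeCoeff n * t ^ n * Real.exp (((n : ℝ) + 1) * t)
        ≤ Real.exp (n + 1) * t ^ n * Real.exp (((n : ℝ) + 1) * t) := by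
          gcongr; exact treeCoeff_le n
      _ = Real.exp (1 + t) * (Real.exp (1 + t) * t) ^ n := by
          rw [mul_pow, ← Real.exp_nat_mul, mul_right_comm, ← Real.exp_add, ← mul_assoc,
            ← Real.exp_add]
          ring_nf
  have hrow : HasSum (fun n => treeCoeff n * t ^ n * Real.exp (-((n : ℝ) + 1) * t))
      (∑' p, f p) :=
    hf.hasSum.prod_fiberwise fun n => (hexp _).mul_left _
  have hdiag : ∑' p, f p = 1 := by
    have hsigma : Summable fun c => f (Finset.HasAntidiagonal.sigmaAntidiagonalEquivProd c) :=
      Finset.HasAntidiagonal.sigmaAntidiagonalEquivProd.summable_iff.mpr hf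
    rw [← Finset.HasAntidiagonal.sigmaAntidiagonalEquivProd.tsum_eq f,
      hsigma.tsum_sigma' (fun n => (hasSum_fintype _).summable),
      tsum_eq_single 0]
    · simp [f, treeCoeff]
    · intro m hm
      have h := congrArg (t ^ m * ·) (sum_antidiagonal_treeCoeff_mul m)
      simp only [hm, if_false, mul_zero] at h
      rw [tsum_fintype, ← h, Finset.mul_sum, ← Finset.sum_coe_sort (Finset.HasAntidiagonal.antidiagonal m)]
      refine Finset.sum_congr rfl fun p _ => ?_
      have hp : t ^ m = t ^ p.1.1 * t ^ p.1.2 := by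
        rw [← pow_add, Finset.HasAntidiagonal.mem_antidiagonal.mp p.2]
      simp only [f, Finset.HasAntidiagonal.sigmaAntidiagonalEquivProd_apply]
      rw [hp, mul_pow]
      ring
  have hser : treeSeries (t * Real.exp (-t)) * Real.exp (-t) = 1 := by
    rw [← hdiag, ← hrow.tsum_eq, treeSeries, ← tsum_mul_right]
    refine tsum_congr fun n => ?_
    rw [mul_pow, ← Real.exp_nat_mul, mul_assoc, mul_assoc, ← Real.exp_add, mul_assoc]
    ring_nf
  rw [eq_div_of_mul_eq (Real.exp_ne_zero _) hser, Real.exp_neg, one_div, inv_inv]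

open scoped NNReal in
lemma analyticOnNhd_treeSeries :
    AnalyticOnNhd ℝ treeSeries (Metric.ball 0 (Real.exp (-1))) := by
  let r : ℝ≥0 := ⟨Real.exp (-1), (Real.exp_pos _).le⟩
  let p := FormalMultilinearSeries.ofScalars ℝ treeCoeff
  have hr : (r : ENNReal) ≤ p.radius := by
    refine p.le_radius_of_bound (Real.exp 1) fun n => ?_
    rw [FormalMultilinearSeries.ofScalars_norm, Real.norm_of_nonneg (treeCoeff_nonneg n)]
    calc treeCoeff n * (r : ℝ) ^ n ≤ Real.exp (n + 1) * (r : ℝ) ^ n := by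
          gcongr; exact treeCoeff_le n
      _ = Real.exp 1 := by
          change Real.exp (n + 1) * Real.exp (-1) ^ n = _
          rw [← Real.exp_nat_mul, ← Real.exp_add]
          ring_nf
  have hrpos : (0 : ENNReal) < r := by
    exact ENNReal.coe_pos.2 (Real.exp_pos (-1) : (0 : ℝ) < r)
  have h := ((p.hasFPowerSeriesOnBall (hrpos.trans_le hr)).mono hrpos hr).analyticOnNhd
  have hsum : p.sum = treeSeries := FormalMultilinearSeries.ofScalarsSum_eq_tsum treeCoeff
  rwa [hsum, Metric.eball_coe] at h

open Filter Topology in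
/-- The tree function `x * treeSeries x` solves `T = x * exp T` inside the disc of convergence. -/
lemma treeSeries_eq_exp {x : ℝ} (hx : |x| < Real.exp (-1)) :
    treeSeries x = Real.exp (x * treeSeries x) := by
  refine analyticOnNhd_treeSeries.eqOn_of_preconnected_of_frequently_eq
    (g := fun x => Real.exp (x * treeSeries x)) (z₀ := 0)
    (analyticOnNhd_id.mul analyticOnNhd_treeSeries).rexp
    (convex_ball _ _).isPreconnected (Metric.mem_ball_self (Real.exp_pos _)) ?_ (by simpa using hx)
  have hsubst : Tendsto (fun t : ℝ => t * Real.exp (-t)) (𝓝[>] 0) (𝓝[≠] 0) := by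
    refine tendsto_nhdsWithin_iff.2 ⟨?_, ?_⟩
    · have : Continuous fun t : ℝ => t * Real.exp (-t) := by fun_prop
      simpa using (this.tendsto 0).mono_left nhdsWithin_le_nhds
    · filter_upwards [self_mem_nhdsWithin] with t ht
      exact mul_ne_zero (ne_of_gt ht) (Real.exp_ne_zero _)
  have hsmall : ∀ᶠ t : ℝ in 𝓝[>] 0, Real.exp (1 + t) * t < 1 := by
    have : Continuous fun t : ℝ => Real.exp (1 + t) * t := by fun_prop
    exact nhdsWithin_le_nhds ((this.tendsto 0).eventually_lt_const (by simp))
  refine hsubst.frequently (Eventually.frequently ?_)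
  filter_upwards [self_mem_nhdsWithin, hsmall] with t ht0 ht
  rw [treeSeries_mul_exp_neg (le_of_lt ht0) ht, mul_assoc, ← Real.exp_add]
  simp

/-- The probability generating function `G_X(s) = Σ_{n≥1} s^n e^{-μn}(μn)^{n-1}/n!`
of a Borel distributed random variable with parameter `μ ∈ (0,1)` satisfies the
functional equation `G_X(s) = s · e^{μ(G_X(s) - 1)}` for all `s ∈ [-1,1]`. -/
theorem borel_pgf_functional_equation (μ : ℝ) (hμ0 : 0 < μ) (hμ1 : μ < 1)
    (G : ℝ → ℝ)
    (hG : ∀ s : ℝ, G s =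
      ∑' n : ℕ, s ^ (n + 1) *
        (Real.exp (-μ * (n + 1)) * (μ * (n + 1)) ^ n / (n + 1).factorial)) :
    ∀ s ∈ Set.Icc (-1 : ℝ) 1, G s = s * Real.exp (μ * (G s - 1)) := by
  intro s hs
  have hGs : G s = s * Real.exp (-μ) * treeSeries (μ * s * Real.exp (-μ)) := by
    rw [hG, treeSeries, ← tsum_mul_left]
    refine tsum_congr fun n => ?_
    rw [show -μ * ((n : ℝ) + 1) = n * (-μ) + -μ by ring, Real.exp_add, Real.exp_nat_mul, treeCoeff,
      mul_pow μ ((n : ℝ) + 1)]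
    ring
  have hx : |μ * s * Real.exp (-μ)| < Real.exp (-1) := by
    have h := Real.add_one_lt_exp (x := μ - 1) (by linarith)
    rw [abs_mul, abs_mul, Real.abs_exp, abs_of_pos hμ0]
    calc μ * |s| * Real.exp (-μ) ≤ μ * 1 * Real.exp (-μ) := by
          gcongr; exact abs_le.2 hs
      _ < Real.exp (μ - 1) * Real.exp (-μ) := by
          gcongr; linarith
      _ = Real.exp (-1) := by rw [← Real.exp_add]; ring_nf
  have hμG : μ * (G s - 1) =
      -μ + μ * s * Real.exp (-μ) * treeSeries (μ * s * Real.exp (-μ)) := by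
    rw [hGs]; ring
  rw [hμG, Real.exp_add, ← treeSeries_eq_exp hx, hGs, mul_assoc]
end

section
/- Let X be Borel distributed with parameter μ ∈ (0,1), with moment generating function M_X(τ) = E[e^{τX}] (finite for τ < μ − 1 − log μ) and cumulant generating function K_X = log M_X. Then for every integer n ≥ 2, the n-th cumulant of X satisfies κ_X^{(n)} := K_X^{(n)}(0) = μ · M_X^{(n)}(0) = μ · E[X^n], where K_X^{(n)}(0) and M_X^{(n)}(0) denote n-th derivatives at 0. -/
open Finset in
theorem sum_range_alternating_choose_succ_mul_pow (m : ℕ) :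
    ∑ i ∈ range (m + 1), ((m + 1).choose (i + 1) : ℝ) * (-1) ^ (m - i) * ((i : ℝ) + 1) ^ m
      = 0 ^ m := by
  have h := fwdDiff_iter_eq_sum_shift (1 : ℝ) (fun r : ℝ ↦ r ^ m) (m + 1) 0
  rw [fwdDiff_iter_pow_eq_zero_of_lt (Nat.lt_succ_self m), sum_range_succ'] at h
  simp only [Nat.add_sub_add_right, zsmul_eq_mul, nsmul_eq_mul] at h
  push_cast at h
  simp only [zero_add, mul_one, Pi.zero_apply, Nat.choose_zero_right, Nat.cast_one] at h
  have h' : (-1 : ℝ) ^ (m + 1) * 0 ^ m = -0 ^ m := by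
    rcases m with _ | m <;> simp
  rw [h'] at h
  calc _ = ∑ i ∈ range (m + 1), (-1 : ℝ) ^ (m - i) * ((m + 1).choose (i + 1) : ℝ)
        * ((i : ℝ) + 1) ^ m := sum_congr rfl fun i _ ↦ by ring
    _ = _ := by linarith

open Finset in
/-- A special case of Abel's binomial identity. -/
theorem sum_range_choose_succ_mul_pow_mul_pow (N : ℕ) :
    ∑ i ∈ range (N + 1), ((N + 1).choose (i + 1) : ℝ) * ((i : ℝ) + 1) ^ i *
      ((N - i : ℕ) : ℝ) ^ (N - i) = ((N : ℝ) + 1) ^ (N + 1) := by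
  calc
    _ = ∑ i ∈ range (N + 1), ∑ j ∈ range (N - i + 1), ((N + 1).choose j : ℝ) * ((N : ℝ) + 1) ^ j *
          (((N - j + 1).choose (i + 1) : ℝ) * (-1) ^ (N - j - i) * ((i : ℝ) + 1) ^ (N - j)) := by
      refine sum_congr rfl fun i hi ↦ ?_
      have hi : i ≤ N := Nat.lt_succ_iff.mp (mem_range.mp hi)
      have hsub : ((N - i : ℕ) : ℝ) = ((N : ℝ) + 1) + (-1) * ((i : ℝ) + 1) := by
        rw [Nat.cast_sub hi]; ring
      rw [hsub, add_pow ((N : ℝ) + 1), mul_sum]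
      refine sum_congr rfl fun j hj ↦ ?_
      have hj : j ≤ N - i := Nat.lt_succ_iff.mp (mem_range.mp hj)
      have hc : (N + 1).choose (i + 1) * (N - i).choose j
          = (N + 1).choose j * (N - j + 1).choose (i + 1) := by
        have h₁ := Nat.choose_mul (n := N + 1) (k := i + 1 + j) (s := i + 1) (by omega)
        have h₂ := Nat.choose_mul (n := N + 1) (k := i + 1 + j) (s := j) (by omega)
        have h₃ : (i + 1 + j).choose (i + 1) = (i + 1 + j).choose j :=
          Nat.choose_symm_add
        rw [h₃, h₂] at h₁
        rw [show N + 1 - (i + 1) = N - i by omega, show i + 1 + j - (i + 1) = j by omega,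
          show N + 1 - j = N - j + 1 by omega, show i + 1 + j - j = i + 1 by omega] at h₁
        exact h₁.symm
      have hc' : ((N + 1).choose (i + 1) : ℝ) * (N - i).choose j
          = (N + 1).choose j * (N - j + 1).choose (i + 1) := mod_cast hc
      rw [mul_pow, show N - i - j = N - j - i by omega,
        show N - j = i + (N - j - i) by omega, pow_add, show i + (N - j - i) = N - j by omega]
      linear_combination ((i : ℝ) + 1) ^ i * ((N : ℝ) + 1) ^ j * (-1) ^ (N - j - i) *
        ((i : ℝ) + 1) ^ (N - j - i) * hc'
    _ = ∑ j ∈ range (N + 1), ∑ i ∈ range (N - j + 1), ((N + 1).choose j : ℝ) * ((N : ℝ) + 1) ^ j *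
          (((N - j + 1).choose (i + 1) : ℝ) * (-1) ^ (N - j - i) * ((i : ℝ) + 1) ^ (N - j)) := by
      refine sum_comm' fun i j ↦ ?_
      simp only [mem_range]
      omega
    _ = ∑ j ∈ range (N + 1), ((N + 1).choose j : ℝ) * ((N : ℝ) + 1) ^ j * 0 ^ (N - j) := by
      refine sum_congr rfl fun j _ ↦ ?_
      rw [← mul_sum, sum_range_alternating_choose_succ_mul_pow]
    _ = ((N : ℝ) + 1) ^ (N + 1) := by
      rw [sum_range_succ, sum_eq_zero]
      · simp [pow_succ, mul_comm]
      · intro j hj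
        rw [zero_pow (by have := mem_range.mp hj; omega), mul_zero]

open Finset in
theorem sum_range_borel_convolution (N : ℕ) :
    ∑ i ∈ range (N + 1), (((i : ℝ) + 1) ^ i / (i + 1).factorial) *
      (((N - i : ℕ) : ℝ) ^ (N - i) / (N - i).factorial)
      = ((N : ℝ) + 1) ^ (N + 1) / (N + 1).factorial := by
  rw [← sum_range_choose_succ_mul_pow_mul_pow, sum_div]
  refine sum_congr rfl fun i hi ↦ ?_
  have hi : i ≤ N := Nat.lt_succ_iff.mp (mem_range.mp hi)
  rw [Nat.cast_choose ℝ (by omega : i + 1 ≤ N + 1), Nat.add_sub_add_right]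
  have h₁ : ((i + 1).factorial : ℝ) ≠ 0 := by positivity
  have h₂ : ((N - i).factorial : ℝ) ≠ 0 := by positivity
  have h₃ : ((N + 1).factorial : ℝ) ≠ 0 := by positivity
  field_simp

theorem iteratedDeriv_eqOn_of_hasDerivAt_succ {s : Set ℝ} (hs : IsOpen s) {G : ℕ → ℝ → ℝ}
    (hG : ∀ n, ∀ x ∈ s, HasDerivAt (G n) (G (n + 1) x) x) (n : ℕ) :
    Set.EqOn (iteratedDeriv n (G 0)) (G n) s := by
  induction n with
  | zero => intro x _; simp
  | succ n ih =>
    intro x hx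
    rw [iteratedDeriv_succ, (ih.eventuallyEq_of_mem (hs.mem_nhds hx)).deriv_eq, (hG n x hx).deriv]

section ExponentialSeries

variable {c : ℕ → ℝ} {A T : ℝ}

theorem summable_pow_mul_exp_mul (hc : ∀ k, |c k| ≤ A * Real.exp (-T * (k + 1))) (n : ℕ) {τ : ℝ}
    (hτ : τ < T) :
    Summable fun k : ℕ ↦ ((k : ℝ) + 1) ^ n * (Real.exp (τ * (k + 1)) * |c k|) := by
  have hr : ‖Real.exp (τ - T)‖ < 1 := by
    rw [Real.norm_eq_abs, abs_of_pos (Real.exp_pos _), Real.exp_lt_one_iff]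
    linarith
  have hs := summable_pow_mul_geometric_of_norm_lt_one n hr
  rw [← summable_nat_add_iff 1] at hs
  refine Summable.of_nonneg_of_le (fun k ↦ by positivity) (fun k ↦ ?_) (hs.mul_left A)
  calc ((k : ℝ) + 1) ^ n * (Real.exp (τ * (k + 1)) * |c k|)
      ≤ ((k : ℝ) + 1) ^ n * (Real.exp (τ * (k + 1)) * (A * Real.exp (-T * (k + 1)))) := by
        gcongr
        exact hc k
    _ = A * (((k + 1 : ℕ) : ℝ) ^ n * Real.exp (τ - T) ^ (k + 1)) := by
        rw [← Real.exp_nat_mul,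
          show ((k + 1 : ℕ) : ℝ) * (τ - T) = τ * (k + 1) + -T * (k + 1) by push_cast; ring,
          Real.exp_add]
        push_cast
        ring

theorem hasDerivAt_tsum_pow_mul_exp_mul (hc : ∀ k, |c k| ≤ A * Real.exp (-T * (k + 1))) (n : ℕ)
    {τ : ℝ} (hτ : τ < T) :
    HasDerivAt (fun τ ↦ ∑' k : ℕ, ((k : ℝ) + 1) ^ n * (Real.exp (τ * (k + 1)) * c k))
      (∑' k : ℕ, ((k : ℝ) + 1) ^ (n + 1) * (Real.exp (τ * (k + 1)) * c k)) τ := by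
  obtain ⟨ρ, hτρ, hρT⟩ := exists_between hτ
  refine hasDerivAt_tsum_of_isPreconnected (t := Set.Iio ρ)
    (g := fun (k : ℕ) τ ↦ ((k : ℝ) + 1) ^ n * (Real.exp (τ * (k + 1)) * c k))
    (g' := fun (k : ℕ) τ ↦ ((k : ℝ) + 1) ^ (n + 1) * (Real.exp (τ * (k + 1)) * c k))
    (summable_pow_mul_exp_mul hc (n + 1) hρT) isOpen_Iio isPreconnected_Iio
    (fun k y _ ↦ ?_) (fun k y hy ↦ ?_) (Set.mem_Iio.mpr hτρ) ?_
    (Set.mem_Iio.mpr hτρ)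
  · have h := (((hasDerivAt_id y).mul_const ((k : ℝ) + 1)).exp.mul_const (c k)).const_mul
      (((k : ℝ) + 1) ^ n)
    refine h.congr_deriv ?_
    simp only [id]
    ring
  · rw [norm_mul, norm_mul, Real.norm_eq_abs (c k), Real.norm_of_nonneg (Real.exp_pos _).le,
      Real.norm_of_nonneg (by positivity)]
    have hy : y ≤ ρ := le_of_lt hy
    gcongr
  · refine (summable_pow_mul_exp_mul hc n hτ).of_norm_bounded fun k ↦ le_of_eq ?_
    rw [norm_mul, norm_mul, Real.norm_eq_abs (c k), Real.norm_of_nonneg (Real.exp_pos _).le,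
      Real.norm_of_nonneg (by positivity)]

end ExponentialSeries

section Borel

/-- The probability that a Borel random variable with parameter `μ` equals `k + 1`. -/
noncomputable def borelWeight (μ : ℝ) (k : ℕ) : ℝ :=
  Real.exp (-μ * (k + 1)) * (μ * (k + 1)) ^ k / (k + 1).factorial

/-- The `n`-th derivative of the moment generating function of the Borel distribution. -/
noncomputable def borelMgfDeriv (μ : ℝ) (n : ℕ) (τ : ℝ) : ℝ :=
  ∑' k : ℕ, ((k : ℝ) + 1) ^ n * (Real.exp (τ * (k + 1)) * borelWeight μ k)

variable {μ : ℝ}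

theorem borelWeight_pos (hμ : 0 < μ) (k : ℕ) : 0 < borelWeight μ k := by
  unfold borelWeight
  positivity

theorem abs_borelWeight_le (hμ : 0 < μ) (k : ℕ) :
    |borelWeight μ k| ≤ μ⁻¹ * Real.exp (-(μ - 1 - Real.log μ) * (k + 1)) := by
  rw [abs_of_pos (borelWeight_pos hμ k), borelWeight]
  have h := Real.pow_div_factorial_le_exp (x := (k : ℝ) + 1) (by positivity) (k + 1)
  have hk : ((k : ℝ) + 1) ^ k ≤ ((k : ℝ) + 1) ^ (k + 1) :=
    pow_le_pow_right₀ (by linarith [k.cast_nonneg (α := ℝ)]) k.le_succ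
  have hlog : Real.exp (Real.log μ * (k + 1)) = μ ^ (k + 1) := by
    rw [mul_comm, ← Real.exp_log (pow_pos hμ _), Real.log_pow]
    push_cast
    rfl
  calc Real.exp (-μ * (k + 1)) * (μ * (k + 1)) ^ k / (k + 1).factorial
      = Real.exp (-μ * (k + 1)) * μ ^ k * (((k : ℝ) + 1) ^ k / (k + 1).factorial) := by
        rw [mul_pow]; ring
    _ ≤ Real.exp (-μ * (k + 1)) * μ ^ k * Real.exp (k + 1) := by
        gcongr
        refine le_trans ?_ h
        gcongr
    _ = _ := by
        rw [show -(μ - 1 - Real.log μ) * ((k : ℝ) + 1)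
          = -μ * (k + 1) + (k + 1) + Real.log μ * (k + 1) by ring,
          Real.exp_add _ (Real.log μ * _), Real.exp_add (-μ * _), hlog]
        generalize Real.exp (-μ * (k + 1)) = a
        generalize Real.exp ((k : ℝ) + 1) = b
        field_simp
        ring

theorem hasDerivAt_borelMgfDeriv (hμ : 0 < μ) (n : ℕ) {τ : ℝ} (hτ : τ < μ - 1 - Real.log μ) :
    HasDerivAt (borelMgfDeriv μ n) (borelMgfDeriv μ (n + 1) τ) τ :=
  hasDerivAt_tsum_pow_mul_exp_mul (abs_borelWeight_le hμ) n hτ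

theorem summable_borelMgfDeriv (hμ : 0 < μ) (n : ℕ) {τ : ℝ} (hτ : τ < μ - 1 - Real.log μ) :
    Summable fun k : ℕ ↦ ((k : ℝ) + 1) ^ n * (Real.exp (τ * (k + 1)) * borelWeight μ k) :=
  (summable_pow_mul_exp_mul (abs_borelWeight_le hμ) n hτ).congr fun k ↦ by
    rw [abs_of_pos (borelWeight_pos hμ k)]

theorem borelMgfDeriv_pos (hμ : 0 < μ) (n : ℕ) {τ : ℝ} (hτ : τ < μ - 1 - Real.log μ) :
    0 < borelMgfDeriv μ n τ := by
  have h (k : ℕ) : 0 < ((k : ℝ) + 1) ^ n * (Real.exp (τ * (k + 1)) * borelWeight μ k) := by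
    have := borelWeight_pos hμ k
    positivity
  exact (summable_borelMgfDeriv hμ n hτ).tsum_pos (fun k ↦ (h k).le) 0 (h 0)

theorem exp_mul_borelWeight (μ τ : ℝ) (k : ℕ) :
    Real.exp (τ * (k + 1)) * borelWeight μ k =
      Real.exp (τ - μ) * (μ * Real.exp (τ - μ)) ^ k * (((k : ℝ) + 1) ^ k / (k + 1).factorial) := by
  have h : Real.exp (τ * (k + 1)) * Real.exp (-μ * (k + 1)) = Real.exp (τ - μ) ^ (k + 1) := by
    rw [← Real.exp_add, ← Real.exp_nat_mul]
    congr 1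
    push_cast
    ring
  rw [borelWeight, mul_pow, mul_pow]
  linear_combination μ ^ k * (((k : ℝ) + 1) ^ k / (k + 1).factorial) * h

/-- The differential equation satisfied by the Borel moment generating function. -/
theorem borelMgfDeriv_one_eq (hμ : 0 < μ) {τ : ℝ} (hτ : τ < μ - 1 - Real.log μ) :
    borelMgfDeriv μ 1 τ = borelMgfDeriv μ 0 τ * (1 + μ * borelMgfDeriv μ 1 τ) := by
  set x := μ * Real.exp (τ - μ) with hx
  have hx0 : 0 < x := by positivity
  let g : ℕ → ℝ := fun k ↦ x ^ k * ((k : ℝ) ^ k / k.factorial)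
  have hg_succ (k : ℕ) : g (k + 1)
      = μ * (((k : ℝ) + 1) ^ 1 * (Real.exp (τ * (k + 1)) * borelWeight μ k)) := by
    rw [exp_mul_borelWeight, ← hx]
    simp only [g]
    rw [pow_succ x, Nat.cast_succ, pow_succ ((k : ℝ) + 1)]
    linear_combination x ^ k * (((k : ℝ) + 1) ^ k * ((k : ℝ) + 1) / (k + 1).factorial) * hx
  have hg : Summable g := (summable_nat_add_iff 1).mp <| by
    simp_rw [hg_succ]
    exact (summable_borelMgfDeriv hμ 1 hτ).mul_left μ
  have hg_tsum : ∑' k, g k = 1 + μ * borelMgfDeriv μ 1 τ := by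
    rw [hg.tsum_eq_zero_add]
    simp_rw [hg_succ, tsum_mul_left]
    simp [g, borelMgfDeriv]
  have hf := summable_borelMgfDeriv hμ 0 hτ
  rw [← hg_tsum, borelMgfDeriv, borelMgfDeriv,
    tsum_mul_tsum_eq_tsum_sum_range_of_summable_norm hf.norm hg.norm]
  refine tsum_congr fun N ↦ ?_
  rw [exp_mul_borelWeight, ← hx]
  calc _ = Real.exp (τ - μ) * x ^ N * (((N : ℝ) + 1) ^ (N + 1) / (N + 1).factorial) := by ring
    _ = _ := by
      rw [← sum_range_borel_convolution, Finset.mul_sum]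
      refine Finset.sum_congr rfl fun i hi ↦ ?_
      have hi : i ≤ N := Nat.lt_succ_iff.mp (Finset.mem_range.mp hi)
      rw [exp_mul_borelWeight, ← hx]
      simp only [g]
      conv_lhs => rw [← Nat.add_sub_cancel' hi, pow_add, Nat.add_sub_cancel' hi]
      ring

end Borel

/-- For a Borel distributed random variable with parameter `μ ∈ (0,1)`, with MGF
`M_X` and cumulant generating function `K_X = log M_X`, for every `n ≥ 2` the
`n`-th cumulant satisfies `κ_X^{(n)} = K_X^{(n)}(0) = μ · M_X^{(n)}(0) = μ · E[X^n]`. -/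
theorem borel_cumulant_eq_mu_mul_moment (μ : ℝ) (hμ0 : 0 < μ) (hμ1 : μ < 1)
    (M K : ℝ → ℝ)
    (hM : ∀ τ : ℝ, M τ =
      ∑' k : ℕ, Real.exp (τ * (k + 1)) *
        (Real.exp (-μ * (k + 1)) * (μ * (k + 1)) ^ k / (k + 1).factorial))
    (hK : ∀ τ : ℝ, K τ = Real.log (M τ)) :
    ∀ n : ℕ, 2 ≤ n →
      iteratedDeriv n K 0 = μ * iteratedDeriv n M 0 ∧
      iteratedDeriv n M 0 =
        ∑' k : ℕ, ((k : ℝ) + 1) ^ n *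
          (Real.exp (-μ * (k + 1)) * (μ * (k + 1)) ^ k / (k + 1).factorial) := by
  have hT : 0 < μ - 1 - Real.log μ := by
    have := Real.log_lt_sub_one_of_pos hμ0 hμ1.ne
    linarith
  have hM0 : M = borelMgfDeriv μ 0 := by
    funext τ
    simp [hM, borelMgfDeriv, borelWeight]
  have hMn (n : ℕ) : iteratedDeriv n M 0 = borelMgfDeriv μ n 0 := by
    rw [hM0]
    exact iteratedDeriv_eqOn_of_hasDerivAt_succ (G := borelMgfDeriv μ) isOpen_Iio
      (fun n _ hτ ↦ hasDerivAt_borelMgfDeriv hμ0 n hτ) n (Set.mem_Iio.mpr hT)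
  intro n hn
  obtain ⟨m, rfl⟩ := Nat.exists_eq_add_of_le' hn
  refine ⟨?_, ?_⟩
  · let G : ℕ → ℝ → ℝ := fun
      | 0 => K
      | 1 => fun τ ↦ 1 + μ * borelMgfDeriv μ 1 τ
      | n + 2 => fun τ ↦ μ * borelMgfDeriv μ (n + 2) τ
    have hG : ∀ n, ∀ τ ∈ Set.Iio (μ - 1 - Real.log μ), HasDerivAt (G n) (G (n + 1) τ) τ := by
      rintro (_ | _ | n) τ hτ
      · have hpos := borelMgfDeriv_pos hμ0 0 hτ
        have hK' : K = fun τ ↦ Real.log (borelMgfDeriv μ 0 τ) := by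
          funext τ
          rw [hK, hM0]
        change HasDerivAt K (1 + μ * borelMgfDeriv μ 1 τ) τ
        rw [hK']
        refine ((hasDerivAt_borelMgfDeriv hμ0 0 hτ).log hpos.ne').congr_deriv ?_
        rw [div_eq_iff hpos.ne', mul_comm]
        exact borelMgfDeriv_one_eq hμ0 hτ
      · exact ((hasDerivAt_borelMgfDeriv hμ0 1 hτ).const_mul μ).const_add 1
      · exact (hasDerivAt_borelMgfDeriv hμ0 (n + 2) hτ).const_mul μ
    rw [hMn]
    exact iteratedDeriv_eqOn_of_hasDerivAt_succ isOpen_Iio hG (m + 2) (Set.mem_Iio.mpr hT)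
  · simp [hMn, borelMgfDeriv, borelWeight]
end

section
/- Let X be Borel distributed with parameter μ ∈ (0,1). Then E[X] = 1/(1−μ). -/
open Finset Real Filter Topology Nat

/-- The `N`-th finite difference of `x ↦ x ^ N` at `1`, written as a sum over the antidiagonal. -/
theorem sum_antidiagonal_neg_one_pow_mul_add_one_pow (N : ℕ) :
    ∑ p ∈ antidiagonal N,
      (-1 : ℝ) ^ p.2 * ((p.1 : ℝ) + 1) ^ N / ((p.1 ! : ℝ) * p.2 !) = 1 := by
  have h := congrFun (fwdDiff_iter_eq_factorial (R := ℝ) (n := N)) 1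
  rw [fwdDiff_iter_eq_sum_shift,
    ← Finset.Nat.sum_antidiagonal_eq_sum_range_succ
      (fun i j ↦ ((-1 : ℤ) ^ j * (N.choose i : ℤ)) • ((1 : ℝ) + i • (1 : ℝ)) ^ N)] at h
  have hN : (N ! : ℝ) ≠ 0 := by positivity
  refine mul_right_injective₀ hN ?_
  simp only [mul_one, Finset.mul_sum]
  refine Eq.trans (Finset.sum_congr rfl fun p hp ↦ ?_) h
  obtain rfl := mem_antidiagonal.1 hp
  have hc : ((p.1 + p.2).choose p.1 : ℝ) * p.1 ! * p.2 ! = (p.1 + p.2)! := by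
    rw [Nat.choose_symm_add]
    exact_mod_cast Nat.add_choose_mul_factorial_mul_factorial p.1 p.2
  rw [← hc]
  simp only [zsmul_eq_mul, nsmul_eq_mul, mul_one, Int.cast_mul, Int.cast_pow, Int.cast_neg,
    Int.cast_one, Int.cast_natCast, add_comm (1 : ℝ)]
  field_simp

theorem add_one_pow_div_factorial_le_exp (n : ℕ) :
    ((n : ℝ) + 1) ^ n / n ! ≤ exp (n + 1) :=
  pow_div_factorial_le_exp _ (by positivity) n

/-- For small parameters the series is summed by expanding the exponential and rearranging. -/
theorem tsum_exp_neg_mul_pow_div_factorial_of_small {μ : ℝ} (h0 : 0 < μ) (h1 : μ < 1 / 10) :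
    ∑' n : ℕ, exp (-μ * (n + 1)) * (μ * (n + 1)) ^ n / n ! = 1 / (1 - μ) := by
  set F : ℕ × ℕ → ℝ := fun p ↦
    (μ * (p.1 + 1)) ^ p.1 / p.1 ! * ((-μ * (p.1 + 1)) ^ p.2 / p.2 !) with hF
  have hexp (x : ℝ) : HasSum (fun k : ℕ ↦ x ^ k / k !) (exp x) := by
    rw [Real.exp_eq_exp_ℝ]
    exact NormedSpace.expSeries_div_hasSum_exp x
  have hrow (n : ℕ) : HasSum (fun k ↦ F (n, k))
      (exp (-μ * (n + 1)) * (μ * (n + 1)) ^ n / n !) := by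
    rw [mul_div_assoc, mul_comm (exp _)]
    exact (hexp (-μ * (n + 1))).mul_left ((μ * (n + 1)) ^ n / n !)
  have hnorm (n : ℕ) : HasSum (fun k ↦ ‖F (n, k)‖)
      ((μ * (n + 1)) ^ n / n ! * exp (μ * (n + 1))) := by
    have habs : |(n : ℝ) + 1| = n + 1 := abs_of_pos (by positivity)
    have heq (k : ℕ) : ‖F (n, k)‖ = (μ * (n + 1)) ^ n / n ! * ((μ * (n + 1)) ^ k / k !) := by
      simp [hF, habs, abs_of_pos h0]
    simp_rw [heq]
    exact (hexp (μ * (n + 1))).mul_left ((μ * (n + 1)) ^ n / n !)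
  have hsmall : μ * exp (μ + 1) < 1 := by
    have h2 : exp (μ + 1) ≤ exp 1 * exp 1 := by
      rw [← exp_add]; exact exp_le_exp.2 (by linarith)
    have h3 := exp_one_lt_d9
    have h4 := exp_pos 1
    nlinarith
  have hFs : Summable F := by
    refine Summable.of_norm ((summable_prod_of_nonneg fun _ ↦ norm_nonneg _).2
      ⟨fun n ↦ (hnorm n).summable, ?_⟩)
    simp_rw [(hnorm _).tsum_eq]
    refine Summable.of_nonneg_of_le (fun n ↦ by positivity) (fun n ↦ ?_)
      ((summable_geometric_of_lt_one (by positivity) hsmall).mul_left (exp (μ + 1)))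
    calc (μ * (n + 1)) ^ n / n ! * exp (μ * (n + 1))
        = μ ^ n * (((n : ℝ) + 1) ^ n / n !) * exp (μ * (n + 1)) := by rw [mul_pow]; ring
      _ ≤ μ ^ n * exp (n + 1) * exp (μ * (n + 1)) := by
          gcongr
          exact add_one_pow_div_factorial_le_exp n
      _ = exp (μ + 1) * (μ * exp (μ + 1)) ^ n := by
          rw [mul_pow, ← exp_nat_mul, mul_assoc, ← exp_add, mul_left_comm, ← exp_add]
          congr 2
          ring
  have hdiag (N : ℕ) : ∑ p ∈ antidiagonal N, F p = μ ^ N := by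
    rw [← mul_one (μ ^ N), ← sum_antidiagonal_neg_one_pow_mul_add_one_pow N, Finset.mul_sum]
    refine Finset.sum_congr rfl fun p hp ↦ ?_
    obtain rfl := mem_antidiagonal.1 hp
    simp only [hF, neg_mul]
    rw [neg_pow (μ * _), mul_pow, mul_pow, pow_add, pow_add]
    field_simp
  calc ∑' n : ℕ, exp (-μ * (n + 1)) * (μ * (n + 1)) ^ n / n !
      = ∑' n, ∑' k, F (n, k) := by simp_rw [(hrow _).tsum_eq]
    _ = ∑' p, F p := (hFs.tsum_prod' fun n ↦ (hrow n).summable).symm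
    _ = ∑' N, ∑ p ∈ antidiagonal N, F p := by
        rw [← HasAntidiagonal.sigmaAntidiagonalEquivProd.tsum_eq F]
        conv_rhs => congr; ext; rw [← Finset.sum_finset_coe,
          ← tsum_fintype (L := .unconditional _)]
        exact (HasAntidiagonal.sigmaAntidiagonalEquivProd.summable_iff.2 hFs).tsum_sigma'
          fun n ↦ (hasSum_fintype _).summable
    _ = 1 / (1 - μ) := by
        simp_rw [hdiag]
        rw [tsum_geometric_of_lt_one h0.le (by linarith), one_div]

/-- The power series `∑ (n + 1) ^ n / n! * y ^ n` is analytic on its disc of convergence. -/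
theorem analyticAt_tsum_add_one_pow_div_factorial {y : ℝ} (hy : |y| < exp (-1)) :
    AnalyticAt ℝ (fun y : ℝ ↦ ∑' n : ℕ, ((n : ℝ) + 1) ^ n / n ! * y ^ n) y := by
  set p := FormalMultilinearSeries.ofScalars ℝ (fun n : ℕ ↦ ((n : ℝ) + 1) ^ n / n !) with hp
  set r : NNReal := ⟨exp (-1), (exp_pos _).le⟩
  have hr : (r : ENNReal) ≤ p.radius := by
    refine p.le_radius_of_bound (exp 1) fun n ↦ ?_
    rw [hp, FormalMultilinearSeries.ofScalars_norm, Real.norm_of_nonneg (by positivity)]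
    calc ((n : ℝ) + 1) ^ n / n ! * exp (-1) ^ n ≤ exp (n + 1) * exp (-1) ^ n := by
          gcongr
          exact add_one_pow_div_factorial_le_exp n
      _ = exp 1 := by
          rw [← exp_nat_mul, ← exp_add]
          congr 1
          ring
  have hpos : 0 < p.radius := lt_of_lt_of_le (ENNReal.coe_pos.2 (exp_pos (-1))) hr
  have hsum : p.sum = fun y : ℝ ↦ ∑' n : ℕ, ((n : ℝ) + 1) ^ n / n ! * y ^ n :=
    FormalMultilinearSeries.ofScalarsSum_eq_tsum _
  rw [← hsum]
  refine (p.hasFPowerSeriesOnBall hpos).analyticAt_of_mem (Metric.eball_subset_eball hr ?_)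
  rw [Metric.eball_coe]
  exact mem_ball_zero_iff.2 hy

/-- A Borel distributed random variable `X` with parameter `μ ∈ (0,1)` has mean
`E[X] = 1/(1-μ)`. -/
theorem borel_mean (μ : ℝ) (hμ0 : 0 < μ) (hμ1 : μ < 1) :
    ∑' n : ℕ, ((n : ℝ) + 1) *
      (Real.exp (-μ * (n + 1)) * (μ * (n + 1)) ^ n / (n + 1).factorial)
      = 1 / (1 - μ) := by
  have hterm (n : ℕ) : ((n : ℝ) + 1) *
      (exp (-μ * (n + 1)) * (μ * (n + 1)) ^ n / (n + 1)!)
      = exp (-μ * (n + 1)) * (μ * (n + 1)) ^ n / n ! := by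
    rw [Nat.factorial_succ]
    push_cast
    field_simp
  simp_rw [hterm]
  set g : ℝ → ℝ := fun y ↦ ∑' n : ℕ, ((n : ℝ) + 1) ^ n / n ! * y ^ n with hg
  have hfactor (x : ℝ) : ∑' n : ℕ, exp (-x * (n + 1)) * (x * (n + 1)) ^ n / n !
      = exp (-x) * g (x * exp (-x)) := by
    rw [hg, ← tsum_mul_left]
    refine tsum_congr fun n ↦ ?_
    rw [mul_add, exp_add, mul_one, mul_comm (-x), exp_nat_mul, mul_pow, mul_pow]
    ring
  have hL : AnalyticOnNhd ℝ (fun x ↦ exp (-x) * g (x * exp (-x))) (Set.Ioo 0 1) := by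
    intro x hx
    have hexp : AnalyticAt ℝ (fun x : ℝ ↦ exp (-x)) x := analyticAt_id.neg.rexp
    refine hexp.mul (AnalyticAt.fun_comp (analyticAt_tsum_add_one_pow_div_factorial ?_)
      (analyticAt_id.mul hexp))
    have h := add_one_lt_exp (x := x - 1) (by linarith [hx.2])
    rw [sub_add_cancel, sub_eq_add_neg, add_comm, exp_add] at h
    rw [abs_of_pos (mul_pos hx.1 (exp_pos _))]
    calc x * exp (-x) < exp (-1) * exp x * exp (-x) := by gcongr
      _ = exp (-1) := by rw [mul_assoc, ← exp_add]; simp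
  have hR : AnalyticOnNhd ℝ (fun x : ℝ ↦ 1 / (1 - x)) (Set.Ioo 0 1) := fun x hx ↦
    analyticAt_const.div (analyticAt_const.sub analyticAt_id) (by simpa using (sub_pos.2 hx.2).ne')
  rw [hfactor]
  refine hL.eqOn_of_preconnected_of_eventuallyEq hR isPreconnected_Ioo
    (z₀ := 1 / 20) (by norm_num) ?_ ⟨hμ0, hμ1⟩
  filter_upwards [Ioo_mem_nhds (show (0 : ℝ) < 1 / 20 by norm_num)
    (show (1 / 20 : ℝ) < 1 / 10 by norm_num)] with x hx
  rw [← hfactor]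
  exact tsum_exp_neg_mul_pow_div_factorial_of_small hx.1 hx.2
end

section
/- Fix 0 < a < b, t > 0, and a real η with η + a ≠ b, and let e_{0,η}(x) = e^{ηx} 1_{[0,t]}(x). Then for every z ∈ [0,t], Σ_{n=1}^∞ (Γⁿ e_{0,η})(z) = a e^{ηz} (e^{(η + a − b)(t − z)} − 1)/(η + a − b). -/
open MeasureTheory

/-- The integral operator `(Γf)(z) = a ∫₀^∞ f(z+y) e^{-by} dy`. -/
noncomputable def hawkesGamma (a b : ℝ) (f : ℝ → ℝ) : ℝ → ℝ :=
  fun z => a * ∫ y in Set.Ioi (0 : ℝ), f (z + y) * Real.exp (-b * y)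

/-- The Volterra operator to which `hawkesGamma` reduces on functions vanishing beyond `t`. -/
noncomputable def hawkesVolterra (a b t : ℝ) (u : ℝ → ℝ) : ℝ → ℝ :=
  fun z => a * Real.exp (b * z) * ∫ x in z..t, u x * Real.exp (-b * x)

theorem continuous_hawkesVolterra (a b t : ℝ) {u : ℝ → ℝ} (hu : Continuous u) :
    Continuous (hawkesVolterra a b t u) := by
  have h : Continuous fun x => u x * Real.exp (-b * x) := by fun_prop
  have h' : Continuous fun z => ∫ x in z..t, u x * Real.exp (-b * x) := by
    refine (intervalIntegral.continuous_primitive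
      (μ := volume) (fun p q => h.intervalIntegrable p q) t).neg.congr fun z => ?_
    exact (intervalIntegral.integral_symm t z).symm
  unfold hawkesVolterra
  fun_prop

theorem continuous_hawkesVolterra_iterate (a b t : ℝ) {u : ℝ → ℝ} (hu : Continuous u) (n : ℕ) :
    Continuous ((hawkesVolterra a b t)^[n] u) := by
  induction n with
  | zero => exact hu
  | succ n ih =>
    rw [Function.iterate_succ_apply']
    exact continuous_hawkesVolterra a b t ih

theorem hawkesVolterra_sub (a b t : ℝ) {u v : ℝ → ℝ} (hu : Continuous u) (hv : Continuous v) :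
    hawkesVolterra a b t (u - v) = hawkesVolterra a b t u - hawkesVolterra a b t v := by
  funext z
  have h1 : Continuous fun x => u x * Real.exp (-b * x) := by fun_prop
  have h2 : Continuous fun x => v x * Real.exp (-b * x) := by fun_prop
  simp only [hawkesVolterra, Pi.sub_apply, sub_mul]
  rw [intervalIntegral.integral_sub (h1.intervalIntegrable _ _) (h2.intervalIntegrable _ _)]
  ring

theorem hawkesVolterra_iterate_sub (a b t : ℝ) {u v : ℝ → ℝ} (hu : Continuous u)
    (hv : Continuous v) (n : ℕ) :
    (hawkesVolterra a b t)^[n] (u - v)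
      = (hawkesVolterra a b t)^[n] u - (hawkesVolterra a b t)^[n] v := by
  induction n with
  | zero => rfl
  | succ n ih =>
    simp only [Function.iterate_succ_apply', ih]
    exact hawkesVolterra_sub a b t (continuous_hawkesVolterra_iterate a b t hu n)
      (continuous_hawkesVolterra_iterate a b t hv n)

theorem hawkesGamma_eq_zero (a b t : ℝ) {F : ℝ → ℝ} (hF : ∀ x, t < x → F x = 0) {z : ℝ}
    (hz : t < z) : hawkesGamma a b F z = 0 := by
  unfold hawkesGamma
  rw [setIntegral_congr_fun (g := fun _ => (0 : ℝ)) measurableSet_Ioi]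
  · simp
  · intro y hy
    have hy' : 0 < y := hy
    simp [hF (z + y) (by linarith)]

theorem hawkesGamma_eq_hawkesVolterra (a b t : ℝ) {F u : ℝ → ℝ} (hF : ∀ x, t < x → F x = 0)
    (hFu : ∀ x ∈ Set.Icc 0 t, F x = u x) {z : ℝ} (hz : z ∈ Set.Icc 0 t) :
    hawkesGamma a b F z = hawkesVolterra a b t u z := by
  have h1 : ∫ y in Set.Ioi (0 : ℝ), F (z + y) * Real.exp (-b * y)
      = ∫ y in (0 : ℝ)..(t - z), F (z + y) * Real.exp (-b * y) := by
    rw [intervalIntegral.integral_of_le (by linarith [hz.2])]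
    refine (setIntegral_eq_of_subset_of_forall_sdiff_eq_zero measurableSet_Ioi
      Set.Ioc_subset_Ioi_self fun y hy => ?_)
    have h : t - z < y := by
      by_contra! h
      exact hy.2 ⟨hy.1, h⟩
    rw [hF (z + y) (by linarith), zero_mul]
  have h2 : ∫ y in (0 : ℝ)..(t - z), F (z + y) * Real.exp (-b * y)
      = ∫ x in z..t, F x * Real.exp (-b * (x - z)) := by
    have h := intervalIntegral.integral_comp_add_left (a := 0) (b := t - z)
      (fun x => F x * Real.exp (-b * (x - z))) z
    simpa using h
  have h3 : ∫ x in z..t, F x * Real.exp (-b * (x - z))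
      = ∫ x in z..t, Real.exp (b * z) * (u x * Real.exp (-b * x)) := by
    refine intervalIntegral.integral_congr fun x hx => ?_
    rw [Set.uIcc_of_le hz.2] at hx
    have he : Real.exp (-b * (x - z)) = Real.exp (b * z) * Real.exp (-b * x) := by
      rw [← Real.exp_add]; ring_nf
    simp only [hFu x ⟨hz.1.trans hx.1, hx.2⟩, he]
    ring
  unfold hawkesGamma hawkesVolterra
  rw [h1, h2, h3, intervalIntegral.integral_const_mul]
  ring

theorem hawkesGamma_iterate_eq_hawkesVolterra_iterate (a b t : ℝ) {F u : ℝ → ℝ}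
    (hF : ∀ x, t < x → F x = 0) (hFu : ∀ x ∈ Set.Icc 0 t, F x = u x) (n : ℕ) :
    (∀ x, t < x → (hawkesGamma a b)^[n] F x = 0) ∧
      ∀ x ∈ Set.Icc 0 t, (hawkesGamma a b)^[n] F x = (hawkesVolterra a b t)^[n] u x := by
  induction n with
  | zero => exact ⟨hF, hFu⟩
  | succ n ih =>
    simp only [Function.iterate_succ_apply']
    exact ⟨fun x hx => hawkesGamma_eq_zero a b t ih.1 hx,
      fun x hx => hawkesGamma_eq_hawkesVolterra a b t ih.1 ih.2 hx⟩

theorem abs_hawkesVolterra_iterate_le {a b t M s : ℝ} (ha : 0 ≤ a) {u : ℝ → ℝ}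
    (hu : Continuous u) (hM : ∀ x ∈ Set.Icc s t, |u x| ≤ M * Real.exp (b * x)) (n : ℕ) :
    ∀ z ∈ Set.Icc s t, |(hawkesVolterra a b t)^[n] u z|
      ≤ M * Real.exp (b * z) * ((a * (t - z)) ^ n / n.factorial) := by
  induction n with
  | zero => simpa using hM
  | succ n ih =>
    intro z hz
    set v := (hawkesVolterra a b t)^[n] u with hv
    have hvc : Continuous v := continuous_hawkesVolterra_iterate a b t hu n
    have hint : |∫ x in z..t, v x * Real.exp (-b * x)|
        ≤ ∫ x in z..t, M * (a ^ n / n.factorial) * (t - x) ^ n := by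
      have hc : Continuous fun x => M * (a ^ n / n.factorial) * (t - x) ^ n := by fun_prop
      rw [← Real.norm_eq_abs]
      refine intervalIntegral.norm_integral_le_of_norm_le hz.2 (.of_forall fun x hx => ?_)
        (hc.intervalIntegrable _ _)
      have hb := ih x ⟨hz.1.trans hx.1.le, hx.2⟩
      rw [Real.norm_eq_abs, abs_mul, Real.abs_exp]
      calc |v x| * Real.exp (-b * x)
          ≤ M * Real.exp (b * x) * ((a * (t - x)) ^ n / n.factorial) * Real.exp (-b * x) := by
            gcongr
        _ = M * (a ^ n / n.factorial) * (t - x) ^ n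
              * (Real.exp (b * x) * Real.exp (-b * x)) := by
            rw [mul_pow]; ring
        _ = _ := by rw [← Real.exp_add]; simp
    have hpow : ∫ x in z..t, (t - x) ^ n = (t - z) ^ (n + 1) / (n + 1) := by
      rw [intervalIntegral.integral_comp_sub_left (fun x => x ^ n) t]
      simp [integral_pow]
    rw [intervalIntegral.integral_const_mul, hpow] at hint
    rw [Function.iterate_succ_apply', ← hv, hawkesVolterra, abs_mul, abs_mul, Real.abs_exp,
      abs_of_nonneg ha]
    calc _ ≤ a * Real.exp (b * z)
          * (M * (a ^ n / n.factorial) * ((t - z) ^ (n + 1) / (n + 1))) := by gcongr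
      _ = _ := by
        rw [Nat.factorial_succ, mul_pow]
        push_cast
        field_simp
        ring

theorem hasSum_hawkesVolterra_iterate {a b t s : ℝ} (ha : 0 ≤ a) {g : ℝ → ℝ}
    (hg : Continuous g) {z : ℝ} (hz : z ∈ Set.Icc s t) :
    HasSum (fun n : ℕ => (hawkesVolterra a b t)^[n + 1] (g - hawkesVolterra a b t g) z)
      (hawkesVolterra a b t g z) := by
  obtain ⟨M, hM⟩ := (isCompact_Icc (a := s) (b := t)).exists_bound_of_continuousOn
    (f := fun x => g x * Real.exp (-(b * x))) (by fun_prop)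
  have hM' : ∀ x ∈ Set.Icc s t, |g x| ≤ M * Real.exp (b * x) := by
    intro x hx
    have h := hM x hx
    rwa [Real.norm_eq_abs, abs_mul, Real.abs_exp, Real.exp_neg, ← div_eq_mul_inv,
      div_le_iff₀ (Real.exp_pos _)] at h
  set r : ℕ → ℝ := fun n => (hawkesVolterra a b t)^[n] g z with hr
  have hsum : Summable r :=
    .of_norm_bounded ((Real.summable_pow_div_factorial (a * (t - z))).mul_left _)
      fun n => abs_hawkesVolterra_iterate_le ha hg hM' n z hz
  have hterm : (fun n : ℕ => (hawkesVolterra a b t)^[n + 1] (g - hawkesVolterra a b t g) z)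
      = fun n => r (n + 1) - r (n + 2) := by
    funext n
    rw [hawkesVolterra_iterate_sub a b t hg (continuous_hawkesVolterra a b t hg), Pi.sub_apply,
      ← Function.iterate_succ_apply]
  have h1 : Summable fun n => r (n + 1) := (summable_nat_add_iff 1).2 hsum
  have h2 : Summable fun n => r (n + 2) := (summable_nat_add_iff 2).2 hsum
  have h := h1.hasSum.sub h2.hasSum
  rw [h1.tsum_eq_zero_add] at h
  rw [hterm]
  simpa [hr] using h

theorem hawkesVolterra_resolvent (a b t η : ℝ) (hη : η + a ≠ b) (z : ℝ) :
    hawkesVolterra a b t (fun x => Real.exp (η * x) + a * Real.exp (η * x)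
        * (Real.exp ((η + a - b) * (t - x)) - 1) / (η + a - b)) z
      = a * Real.exp (η * z) * (Real.exp ((η + a - b) * (t - z)) - 1) / (η + a - b) := by
  have hk : η + a - b ≠ 0 := sub_ne_zero.2 hη
  have hderiv : ∀ x : ℝ, HasDerivAt
      (fun x => -(Real.exp ((η - b) * x) * (Real.exp ((η + a - b) * (t - x)) - 1) / (η + a - b)))
      ((Real.exp (η * x) + a * Real.exp (η * x)
        * (Real.exp ((η + a - b) * (t - x)) - 1) / (η + a - b)) * Real.exp (-b * x)) x := by
    intro x
    have h1 : HasDerivAt (fun x => Real.exp ((η - b) * x)) _ x :=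
      ((hasDerivAt_id x).const_mul (η - b)).exp
    have h2 : HasDerivAt (fun x => Real.exp ((η + a - b) * (t - x))) _ x :=
      (((hasDerivAt_id x).const_sub t).const_mul (η + a - b)).exp
    have he : Real.exp ((η - b) * x) = Real.exp (η * x) * Real.exp (-b * x) := by
      rw [← Real.exp_add]; ring_nf
    refine ((h1.mul (h2.sub_const 1)).div_const (η + a - b)).neg.congr_deriv ?_
    simp only [id, he]
    field_simp
    ring
  unfold hawkesVolterra
  rw [intervalIntegral.integral_eq_sub_of_hasDerivAt (fun x _ => hderiv x)
    (Continuous.intervalIntegrable (by fun_prop) _ _)]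
  have he : Real.exp (η * z) = Real.exp (b * z) * Real.exp ((η - b) * z) := by
    rw [← Real.exp_add]; ring_nf
  rw [he]
  simp
  ring

/-- For `0 < a < b`, `t > 0`, `η + a ≠ b` and `e_{0,η}(x) = e^{ηx} 1_{[0,t]}(x)`, for
every `z ∈ [0,t]`,
`Σ_{n≥1} (Γⁿ e_{0,η})(z) = a e^{ηz} (e^{(η+a-b)(t-z)} - 1)/(η+a-b)`. -/
theorem hawkes_resolvent_exponential (a b t η : ℝ)
    (ha : 0 < a) (hab : a < b) (ht : 0 < t) (hη : η + a ≠ b)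
    (f : ℝ → ℝ)
    (hf : f = Set.indicator (Set.Icc (0 : ℝ) t) (fun x => Real.exp (η * x))) :
    ∀ z ∈ Set.Icc (0 : ℝ) t,
      ∑' n : ℕ, (hawkesGamma a b)^[n + 1] f z
        = a * Real.exp (η * z) * (Real.exp ((η + a - b) * (t - z)) - 1) / (η + a - b) := by
  intro z hz
  set g : ℝ → ℝ := fun x => Real.exp (η * x) + a * Real.exp (η * x)
    * (Real.exp ((η + a - b) * (t - x)) - 1) / (η + a - b) with hg
  have hgc : Continuous g := by fun_prop
  have hres : ∀ x, hawkesVolterra a b t g x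
      = a * Real.exp (η * x) * (Real.exp ((η + a - b) * (t - x)) - 1) / (η + a - b) :=
    hawkesVolterra_resolvent a b t η hη
  have hf0 : ∀ x, t < x → f x = 0 := fun x hx => by
    rw [hf, Set.indicator_of_notMem fun h => hx.not_ge h.2]
  have hfg : ∀ x ∈ Set.Icc 0 t, f x = (g - hawkesVolterra a b t g) x := fun x hx => by
    rw [hf, Set.indicator_of_mem hx, Pi.sub_apply, hres]
    simp [hg]
  rw [← hres, ← (hasSum_hawkesVolterra_iterate ha.le hgc hz).tsum_eq]
  exact tsum_congr fun n =>
    (hawkesGamma_iterate_eq_hawkesVolterra_iterate a b t hf0 hfg (n + 1)).2 z hz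
end

section
/- Fix 0 < a < b and t > 0. Then for every z ∈ [0,t], the first Hawkes cumulant from a single point at z satisfies κ⁽¹⁾(z) := 1 + Σ_{n=1}^∞ (Γⁿ 1_{[0,t]})(z) = b/(b−a) − (a/(b−a)) e^{−(b−a)(t−z)}. -/
open MeasureTheory

/-- The integrand of `hawkesGamma` is integrable for bounded measurable functions. -/
lemma integrableOn_hawkesGamma_integrand {b C : ℝ} (hb : 0 < b) {f : ℝ → ℝ}
    (hf : Measurable f) (hC : ∀ z, |f z| ≤ C) (z : ℝ) :
    IntegrableOn (fun y => f (z + y) * Real.exp (-b * y)) (Set.Ioi 0) :=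
  (integrableOn_exp_mul_Ioi (neg_lt_zero.mpr hb) 0).bdd_mul
    (hf.comp (measurable_const_add z)).aestronglyMeasurable
    (Filter.Eventually.of_forall fun y => hC (z + y))

lemma measurable_hawkesGamma (a b : ℝ) {f : ℝ → ℝ} (hf : Measurable f) :
    Measurable (hawkesGamma a b f) := by
  have h : Measurable (Function.uncurry fun z y : ℝ => f (z + y) * Real.exp (-b * y)) := by
    unfold Function.uncurry
    fun_prop
  exact (h.stronglyMeasurable.integral_prod_right
    (ν := volume.restrict (Set.Ioi (0 : ℝ)))).measurable.const_mul a

lemma abs_hawkesGamma_le {a b C : ℝ} (ha : 0 ≤ a) (hb : 0 < b) {f : ℝ → ℝ}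
    (hC : ∀ z, |f z| ≤ C) (z : ℝ) : |hawkesGamma a b f z| ≤ a / b * C := by
  have hexp := integrableOn_exp_mul_Ioi (neg_lt_zero.mpr hb) 0
  have key : ‖∫ y in Set.Ioi (0 : ℝ), f (z + y) * Real.exp (-b * y)‖
      ≤ ∫ y in Set.Ioi (0 : ℝ), C * Real.exp (-b * y) := by
    refine norm_integral_le_of_norm_le (hexp.const_mul C) (Filter.Eventually.of_forall fun y => ?_)
    rw [norm_mul, Real.norm_eq_abs, Real.norm_eq_abs, Real.abs_exp]
    exact mul_le_mul_of_nonneg_right (hC _) (Real.exp_pos _).le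
  rw [integral_const_mul, integral_exp_mul_Ioi (neg_lt_zero.mpr hb), Real.norm_eq_abs] at key
  unfold hawkesGamma
  rw [abs_mul, abs_of_nonneg ha]
  calc a * _ ≤ a * (C * (-Real.exp (-b * 0) / -b)) := mul_le_mul_of_nonneg_left key ha
    _ = a / b * C := by
      rw [mul_zero, Real.exp_zero, neg_div_neg_eq]
      ring

lemma measurable_iterate_hawkesGamma (a b : ℝ) {f : ℝ → ℝ} (hf : Measurable f) (n : ℕ) :
    Measurable ((hawkesGamma a b)^[n] f) := by
  induction n with
  | zero => exact hf
  | succ n ih =>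
    rw [Function.iterate_succ_apply']
    exact measurable_hawkesGamma a b ih

lemma abs_iterate_hawkesGamma_le {a b C : ℝ} (ha : 0 ≤ a) (hb : 0 < b) {f : ℝ → ℝ}
    (hC : ∀ z, |f z| ≤ C) (n : ℕ) (z : ℝ) :
    |(hawkesGamma a b)^[n] f z| ≤ (a / b) ^ n * C := by
  induction n generalizing z with
  | zero => simpa using hC z
  | succ n ih =>
    rw [Function.iterate_succ_apply', pow_succ', mul_assoc]
    exact abs_hawkesGamma_le ha hb ih z

/-- If `f = k - Γk` on `[0, ∞)`, then `Γⁿf = Γⁿk - Γⁿ⁺¹k` on `[0, ∞)`. -/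
lemma iterate_hawkesGamma_eq_sub {a b C : ℝ} (ha : 0 ≤ a) (hb : 0 < b) {f k : ℝ → ℝ}
    (hk : Measurable k) (hC : ∀ z, |k z| ≤ C)
    (hfk : ∀ z, 0 ≤ z → f z = k z - hawkesGamma a b k z) (n : ℕ) {z : ℝ} (hz : 0 ≤ z) :
    (hawkesGamma a b)^[n] f z
      = (hawkesGamma a b)^[n] k z - (hawkesGamma a b)^[n + 1] k z := by
  induction n generalizing z with
  | zero => exact hfk z hz
  | succ n ih =>
    have hint (m : ℕ) := integrableOn_hawkesGamma_integrand hb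
      (measurable_iterate_hawkesGamma a b hk m) (abs_iterate_hawkesGamma_le ha hb hC m) z
    rw [Function.iterate_succ_apply' _ n f, Function.iterate_succ_apply' _ (n + 1) k,
      congrFun (Function.iterate_succ_apply' _ n k) z]
    have hG (g : ℝ → ℝ) : hawkesGamma a b g z
        = a * ∫ y in Set.Ioi (0 : ℝ), g (z + y) * Real.exp (-b * y) := rfl
    rw [hG, hG, hG, ← mul_sub, ← integral_sub (hint n) (hint (n + 1))]
    congr 1
    refine setIntegral_congr_fun measurableSet_Ioi fun y hy => ?_
    simp only [ih (add_nonneg hz (le_of_lt hy)), sub_mul]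

/-- The resolvent series of `hawkesGamma` on a bounded solution of `k = f + Γk`. -/
lemma tsum_iterate_hawkesGamma {a b C : ℝ} (ha : 0 ≤ a) (hab : a < b) {f k : ℝ → ℝ}
    (hk : Measurable k) (hC : ∀ z, |k z| ≤ C)
    (hfk : ∀ z, 0 ≤ z → f z = k z - hawkesGamma a b k z) {z : ℝ} (hz : 0 ≤ z) :
    ∑' n : ℕ, (hawkesGamma a b)^[n + 1] f z = hawkesGamma a b k z := by
  have hb : 0 < b := ha.trans_lt hab
  have hs : Summable fun n : ℕ => (hawkesGamma a b)^[n] k z :=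
    Summable.of_norm_bounded
      ((summable_geometric_of_lt_one (div_nonneg ha hb.le) ((div_lt_one hb).2 hab)).mul_right C)
      fun n => abs_iterate_hawkesGamma_le ha hb hC n z
  have hs1 := (summable_nat_add_iff 1).2 hs
  have hs2 := (summable_nat_add_iff 1).2 hs1
  simp only [iterate_hawkesGamma_eq_sub ha hb hk hC hfk _ hz]
  rw [hs1.tsum_sub hs2, hs1.tsum_eq_zero_add]
  simp

/-- The closed form of the first cumulant, extended by zero outside `[0, t]`. -/
noncomputable def hawkesCumulant (a b t : ℝ) : ℝ → ℝ :=
  (Set.Icc 0 t).indicator fun z => b / (b - a) - a / (b - a) * Real.exp (-(b - a) * (t - z))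

lemma measurable_hawkesCumulant (a b t : ℝ) : Measurable (hawkesCumulant a b t) :=
  Measurable.indicator (by fun_prop) measurableSet_Icc

lemma abs_hawkesCumulant_le {a b : ℝ} (ha : 0 ≤ a) (hab : a < b) (t z : ℝ) :
    |hawkesCumulant a b t z| ≤ b / (b - a) := by
  have hd : 0 < b - a := sub_pos.2 hab
  have hb : 0 < b := ha.trans_lt hab
  unfold hawkesCumulant
  by_cases hz : z ∈ Set.Icc 0 t
  · rw [Set.indicator_of_mem hz]
    have he : Real.exp (-(b - a) * (t - z)) ≤ 1 :=
      Real.exp_le_one_iff.2 (by nlinarith [hz.2])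
    have h0 : 0 ≤ a / (b - a) * Real.exp (-(b - a) * (t - z)) := by positivity
    have h1 : a / (b - a) * Real.exp (-(b - a) * (t - z)) ≤ a / (b - a) :=
      mul_le_of_le_one_right (by positivity) he
    have h2 : a / (b - a) ≤ b / (b - a) := by gcongr
    rw [abs_of_nonneg (by linarith)]
    linarith
  · rw [Set.indicator_of_notMem hz, abs_zero]
    positivity

lemma hawkesGamma_hawkesCumulant {a b t z : ℝ} (hab : a < b) (hz : z ∈ Set.Icc 0 t) :
    hawkesGamma a b (hawkesCumulant a b t) z
      = a / (b - a) * (1 - Real.exp (-(b - a) * (t - z))) := by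
  have hd : b - a ≠ 0 := (sub_pos.2 hab).ne'
  set F : ℝ → ℝ := fun y => 1 / (b - a) *
    (Real.exp (-(b - a) * (t - z)) * Real.exp (-a * y) - Real.exp (-b * y)) with hF
  have hderiv (y : ℝ) : HasDerivAt F ((b / (b - a) - a / (b - a) *
      Real.exp (-(b - a) * (t - (z + y)))) * Real.exp (-b * y)) y := by
    have hexp (c : ℝ) : HasDerivAt (fun y => Real.exp (c * y)) (Real.exp (c * y) * c) y := by
      simpa using ((hasDerivAt_id y).const_mul c).exp
    convert! (((hexp (-a)).const_mul (Real.exp (-(b - a) * (t - z)))).sub (hexp (-b))).const_mul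
      (1 / (b - a)) using 1
    have : Real.exp (-(b - a) * (t - (z + y))) * Real.exp (-b * y)
        = Real.exp (-(b - a) * (t - z)) * Real.exp (-a * y) := by
      rw [← Real.exp_add, ← Real.exp_add]
      ring_nf
    rw [sub_mul, mul_assoc, this]
    ring
  have hint : ∫ y in Set.Ioi (0 : ℝ), hawkesCumulant a b t (z + y) * Real.exp (-b * y)
      = F (t - z) - F 0 := by
    rw [← intervalIntegral.integral_eq_sub_of_hasDerivAt (fun y _ => hderiv y)
      (Continuous.intervalIntegrable (by fun_prop) _ _),
      intervalIntegral.integral_of_le (sub_nonneg.2 hz.2),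
      ← Set.Ioi_inter_Iic, ← setIntegral_indicator measurableSet_Iic]
    refine setIntegral_congr_fun measurableSet_Ioi fun y hy => ?_
    have hy0 : 0 < y := hy
    by_cases hyt : y ≤ t - z
    · have hmem : z + y ∈ Set.Icc 0 t := ⟨by linarith [hz.1], by linarith⟩
      simp only [hawkesCumulant, Set.indicator_of_mem hmem,
        Set.indicator_of_mem (Set.mem_Iic.2 hyt)]
    · have hmem : z + y ∉ Set.Icc 0 t := fun h => hyt (by linarith [h.2])
      simp only [hawkesCumulant, Set.indicator_of_notMem hmem, zero_mul,
        Set.indicator_of_notMem (mt Set.mem_Iic.1 hyt)]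
  have hcancel : Real.exp (-(b - a) * (t - z)) * Real.exp (-a * (t - z))
      = Real.exp (-b * (t - z)) := by
    rw [← Real.exp_add]
    ring_nf
  rw [hawkesGamma, hint]
  simp only [hF, hcancel, mul_zero, Real.exp_zero, mul_one]
  ring

lemma hawkesGamma_hawkesCumulant_of_lt (a b : ℝ) {t z : ℝ} (hz : t < z) :
    hawkesGamma a b (hawkesCumulant a b t) z = 0 := by
  rw [hawkesGamma, setIntegral_eq_zero_of_forall_eq_zero, mul_zero]
  intro y hy
  have hy0 : 0 < y := hy
  have hmem : z + y ∉ Set.Icc 0 t := fun h => by linarith [h.2]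
  rw [hawkesCumulant, Set.indicator_of_notMem hmem, zero_mul]

lemma indicator_eq_hawkesCumulant_sub {a b t z : ℝ} (hab : a < b) (hz : 0 ≤ z) :
    (Set.Icc (0 : ℝ) t).indicator (fun _ => (1 : ℝ)) z
      = hawkesCumulant a b t z - hawkesGamma a b (hawkesCumulant a b t) z := by
  have hd : b - a ≠ 0 := (sub_pos.2 hab).ne'
  by_cases hzt : z ≤ t
  · have hmem : z ∈ Set.Icc 0 t := ⟨hz, hzt⟩
    rw [hawkesGamma_hawkesCumulant hab hmem, hawkesCumulant, Set.indicator_of_mem hmem,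
      Set.indicator_of_mem hmem]
    field_simp
    ring
  · have hmem : z ∉ Set.Icc 0 t := fun h => hzt h.2
    rw [hawkesGamma_hawkesCumulant_of_lt a b (not_le.1 hzt), hawkesCumulant,
      Set.indicator_of_notMem hmem, Set.indicator_of_notMem hmem, sub_zero]

/-- For `0 < a < b` and `t > 0`, the first Hawkes cumulant from a single point at
`z ∈ [0,t]` satisfies
`κ⁽¹⁾(z) = 1 + Σ_{n≥1} (Γⁿ 1_{[0,t]})(z) = b/(b-a) - (a/(b-a)) e^{-(b-a)(t-z)}`. -/
theorem hawkes_first_cumulant (a b t : ℝ) (ha : 0 < a) (hab : a < b) (ht : 0 < t) :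
    ∀ z ∈ Set.Icc (0 : ℝ) t,
      1 + ∑' n : ℕ,
          (hawkesGamma a b)^[n + 1] (Set.indicator (Set.Icc (0 : ℝ) t) fun _ => (1 : ℝ)) z
        = b / (b - a) - a / (b - a) * Real.exp (-(b - a) * (t - z)) := by
  intro z hz
  have hd : b - a ≠ 0 := (sub_pos.2 hab).ne'
  rw [tsum_iterate_hawkesGamma ha.le hab (measurable_hawkesCumulant a b t)
    (abs_hawkesCumulant_le ha.le hab t) (fun _ => indicator_eq_hawkesCumulant_sub hab) hz.1,
    hawkesGamma_hawkesCumulant hab hz]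
  field_simp
  ring
end

section
/- Fix 0 < a < b, t > 0 and ν > 0. Let κ⁽¹⁾(z) = (b/(b−a) − (a/(b−a)) e^{−(b−a)(t−z)}) · 1_{[0,t]}(z) and κ⁽²⁾(z) = Σ_{m=1}^∞ (Γᵐ (κ⁽¹⁾)²)(z). Then ν ∫₀^t (κ⁽²⁾(z) + (κ⁽¹⁾(z))²) dz = −(ν/(2(a−b)⁴)) (6ab² − a²b + 2b³(a−b)t + 2a(a² − 3b² + 2ab(a−b)t) e^{(a−b)t} + a²(b − 2a) e^{2(a−b)t}). (This is the variance Var[N_t] of the Hawkes process with immigration rate ν.) -/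
open MeasureTheory

/-- A measurable function bounded in absolute value by `C`. -/
def MeasurableBounded (C : ℝ) (f : ℝ → ℝ) : Prop :=
  Measurable f ∧ ∀ z, |f z| ≤ C

lemma MeasurableBounded.integrableOn {C b : ℝ} {f : ℝ → ℝ} (hf : MeasurableBounded C f)
    (hb : 0 < b) (z : ℝ) :
    IntegrableOn (fun y => f (z + y) * Real.exp (-b * y)) (Set.Ioi 0) := by
  refine (integrableOn_exp_mul_Ioi (neg_lt_zero.mpr hb) 0).bdd_mul (c := C)
    (hf.1.comp (measurable_const_add z)).aestronglyMeasurable ?_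
  exact Filter.Eventually.of_forall fun y => hf.2 (z + y)

lemma integral_exp_neg_mul_Ioi_zero {b : ℝ} (hb : 0 < b) :
    ∫ y in Set.Ioi (0 : ℝ), Real.exp (-b * y) = 1 / b := by
  rw [integral_exp_mul_Ioi (neg_lt_zero.mpr hb)]
  simp

lemma MeasurableBounded.hawkesGamma {C a b : ℝ} {f : ℝ → ℝ} (hf : MeasurableBounded C f)
    (ha : 0 < a) (hb : 0 < b) : MeasurableBounded (a / b * C) (hawkesGamma a b f) := by
  refine ⟨?_, fun z => ?_⟩
  · have hm : StronglyMeasurable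
        (Function.uncurry fun z y : ℝ => f (z + y) * Real.exp (-b * y)) := by
      refine Measurable.stronglyMeasurable ?_
      have := hf.1
      simp only [Function.uncurry_def]
      fun_prop
    exact (hm.integral_prod_right (ν := volume.restrict (Set.Ioi 0))).measurable.const_mul a
  · have h : |∫ y in Set.Ioi (0 : ℝ), f (z + y) * Real.exp (-b * y)| ≤
        ∫ y in Set.Ioi (0 : ℝ), C * Real.exp (-b * y) := by
      rw [← Real.norm_eq_abs]
      refine norm_integral_le_of_norm_le
        ((integrableOn_exp_mul_Ioi (neg_lt_zero.mpr hb) 0).const_mul C) ?_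
      refine Filter.Eventually.of_forall fun y => ?_
      rw [norm_mul, Real.norm_of_nonneg (Real.exp_pos _).le]
      exact mul_le_mul_of_nonneg_right (hf.2 _) (Real.exp_pos _).le
    rw [integral_const_mul, integral_exp_neg_mul_Ioi_zero hb] at h
    calc |_root_.hawkesGamma a b f z|
        = a * |∫ y in Set.Ioi (0 : ℝ), f (z + y) * Real.exp (-b * y)| := by
          rw [_root_.hawkesGamma, abs_mul, abs_of_pos ha]
      _ ≤ a * (C * (1 / b)) := mul_le_mul_of_nonneg_left h ha.le
      _ = a / b * C := by ring

lemma MeasurableBounded.iterate_hawkesGamma {C a b : ℝ} {f : ℝ → ℝ}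
    (hf : MeasurableBounded C f) (ha : 0 < a) (hb : 0 < b) (m : ℕ) :
    MeasurableBounded ((a / b) ^ m * C) ((_root_.hawkesGamma a b)^[m] f) := by
  induction m with
  | zero => simpa using hf
  | succ m ih =>
    rw [Function.iterate_succ_apply', pow_succ', mul_assoc]
    exact ih.hawkesGamma ha hb

lemma hawkesGamma_sub {C D a b : ℝ} {f g : ℝ → ℝ} (hf : MeasurableBounded C f)
    (hg : MeasurableBounded D g) (hb : 0 < b) :
    hawkesGamma a b (f - g) = hawkesGamma a b f - hawkesGamma a b g := by
  funext z
  simp only [hawkesGamma, Pi.sub_apply, sub_mul]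
  rw [integral_sub (hf.integrableOn hb z) (hg.integrableOn hb z), mul_sub]

lemma iterate_hawkesGamma_sub {C a b : ℝ} {f : ℝ → ℝ} (hf : MeasurableBounded C f)
    (ha : 0 < a) (hb : 0 < b) (m : ℕ) :
    (hawkesGamma a b)^[m] (f - hawkesGamma a b f) =
      (hawkesGamma a b)^[m] f - (hawkesGamma a b)^[m + 1] f := by
  induction m with
  | zero => rfl
  | succ m ih =>
    rw [Function.iterate_succ_apply', ih, hawkesGamma_sub (hf.iterate_hawkesGamma ha hb m)
      (hf.iterate_hawkesGamma ha hb (m + 1)) hb, ← Function.iterate_succ_apply' (hawkesGamma a b),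
      ← Function.iterate_succ_apply' (hawkesGamma a b)]

/-- The Neumann series of `hawkesGamma`, without its zeroth term. -/
lemma hasSum_iterate_hawkesGamma {C a b : ℝ} {f : ℝ → ℝ} (hf : MeasurableBounded C f)
    (ha : 0 < a) (hab : a < b) (z : ℝ) :
    HasSum (fun m : ℕ => (hawkesGamma a b)^[m + 1] (f - hawkesGamma a b f) z)
      (hawkesGamma a b f z) := by
  have hb := ha.trans hab
  have hs : Summable fun m : ℕ => (hawkesGamma a b)^[m + 1] f z := by
    refine Summable.of_norm_bounded (g := fun m : ℕ => (a / b) ^ (m + 1) * C) ?_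
      fun m => (hf.iterate_hawkesGamma ha hb (m + 1)).2 z
    exact ((summable_nat_add_iff 1).mpr (summable_geometric_of_lt_one (by positivity)
      ((div_lt_one hb).mpr hab))).mul_right C
  have hs' : Summable fun m : ℕ => (hawkesGamma a b)^[m + 1 + 1] f z :=
    (summable_nat_add_iff (f := fun m : ℕ => (hawkesGamma a b)^[m + 1] f z) 1).mpr hs
  have h := hs.hasSum.sub hs'.hasSum
  rw [hs.tsum_eq_zero_add, add_sub_cancel_right] at h
  simpa only [iterate_hawkesGamma_sub hf ha hb, Pi.sub_apply, zero_add,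
    Function.iterate_one] using h

lemma iterate_hawkesGamma_congr {a b r : ℝ} {f g : ℝ → ℝ} (h : Set.EqOn f g (Set.Ici r)) (m : ℕ) :
    Set.EqOn ((hawkesGamma a b)^[m] f) ((hawkesGamma a b)^[m] g) (Set.Ici r) := by
  induction m with
  | zero => exact h
  | succ m ih =>
    intro z hz
    rw [Function.iterate_succ_apply', Function.iterate_succ_apply']
    simp only [hawkesGamma]
    congr 1
    refine setIntegral_congr_fun measurableSet_Ioi fun y hy => ?_
    have hzy : z + y ∈ Set.Ici r := by
      simp only [Set.mem_Ici, Set.mem_Ioi] at *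
      linarith
    simp only [ih hzy]

/-- The mean cluster size accumulated over a duration `s`. -/
noncomputable def clusterMean (a b s : ℝ) : ℝ :=
  b / (b - a) - a / (b - a) * Real.exp (-(b - a) * s)

/-- The solution of `u' = -(b - a) u + a (clusterMean a b) ^ 2` with `u 0 = 0`. -/
noncomputable def clusterCumulant (a b s : ℝ) : ℝ :=
  a / (b - a) ^ 3 * (b ^ 2 * (1 - Real.exp (-(b - a) * s))
    - 2 * a * b * (b - a) * s * Real.exp (-(b - a) * s)
    + a ^ 2 * (Real.exp (-(b - a) * s) - Real.exp (-(b - a) * s) ^ 2))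

lemma hasDerivAt_exp_const_mul (c s : ℝ) :
    HasDerivAt (fun s => Real.exp (c * s)) (c * Real.exp (c * s)) s := by
  simpa [mul_comm] using ((hasDerivAt_id s).const_mul c).exp

lemma hasDerivAt_clusterCumulant {a b : ℝ} (hab : a < b) (s : ℝ) :
    HasDerivAt (clusterCumulant a b)
      (a * clusterMean a b s ^ 2 - (b - a) * clusterCumulant a b s) s := by
  have hE := hasDerivAt_exp_const_mul (-(b - a)) s
  have h := ((((hE.const_sub 1).const_mul (b ^ 2)).sub
    (((hasDerivAt_id s).const_mul (2 * a * b * (b - a))).mul hE)).add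
    ((hE.sub (hE.pow 2)).const_mul (a ^ 2))).const_mul (a / (b - a) ^ 3)
  have hc : b - a ≠ 0 := (sub_pos.mpr hab).ne'
  refine h.congr_deriv ?_
  simp only [clusterMean, clusterCumulant, id]
  field_simp
  ring

lemma continuous_clusterCumulant (a b : ℝ) : Continuous (clusterCumulant a b) := by
  unfold clusterCumulant
  fun_prop

lemma continuous_clusterMean (a b : ℝ) : Continuous (clusterMean a b) := by
  unfold clusterMean
  fun_prop

lemma hawkesGamma_indicator {a b t z : ℝ} (hab : a < b) (hz : z ∈ Set.Icc 0 t) :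
    hawkesGamma a b (Set.indicator (Set.Icc 0 t)
      fun z => clusterCumulant a b (t - z) + clusterMean a b (t - z) ^ 2) z =
      clusterCumulant a b (t - z) := by
  have hset : ∫ y in Set.Ioi (0 : ℝ), Set.indicator (Set.Icc 0 t)
      (fun z => clusterCumulant a b (t - z) + clusterMean a b (t - z) ^ 2) (z + y)
        * Real.exp (-b * y) =
      ∫ y in (0 : ℝ)..(t - z), (clusterCumulant a b (t - z - y)
        + clusterMean a b (t - z - y) ^ 2) * Real.exp (-b * y) := by
    rw [intervalIntegral.integral_of_le (sub_nonneg.mpr hz.2),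
      ← integral_indicator measurableSet_Ioi, ← integral_indicator measurableSet_Ioc]
    congr 1
    funext y
    by_cases h0 : 0 < y
    · by_cases h1 : y ≤ t - z
      · have : z + y ∈ Set.Icc 0 t := ⟨by linarith [hz.1], by linarith⟩
        rw [Set.indicator_of_mem (Set.mem_Ioi.mpr h0), Set.indicator_of_mem this,
          Set.indicator_of_mem (Set.mem_Ioc.mpr ⟨h0, h1⟩), sub_sub]
      · have : z + y ∉ Set.Icc 0 t := fun h => h1 (by linarith [h.2])
        rw [Set.indicator_of_mem (Set.mem_Ioi.mpr h0), Set.indicator_of_notMem this,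
          Set.indicator_of_notMem fun h => h1 (Set.mem_Ioc.mp h).2, zero_mul]
    · simp [Set.indicator, h0]
  have hderiv : ∀ y ∈ Set.uIcc 0 (t - z),
      HasDerivAt (fun y => -(clusterCumulant a b (t - z - y) * Real.exp (-b * y)))
        (a * ((clusterCumulant a b (t - z - y) + clusterMean a b (t - z - y) ^ 2)
          * Real.exp (-b * y))) y := by
    intro y _
    have hK := (hasDerivAt_clusterCumulant hab (t - z - y)).comp_const_sub (t - z) y
    refine (hK.mul (hasDerivAt_exp_const_mul (-b) y)).neg.congr_deriv ?_
    ring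
  have hK := continuous_clusterCumulant a b
  have hM := continuous_clusterMean a b
  have hint := intervalIntegral.integral_eq_sub_of_hasDerivAt hderiv
    (Continuous.intervalIntegrable (by fun_prop) _ _)
  rw [hawkesGamma, hset, ← intervalIntegral.integral_const_mul, hint]
  simp [clusterCumulant]

lemma measurableBounded_indicator_Icc {f : ℝ → ℝ} (hf : Continuous f) (r t : ℝ) :
    ∃ C, MeasurableBounded C (Set.indicator (Set.Icc r t) f) := by
  obtain ⟨C, hC⟩ := isCompact_Icc.exists_bound_of_continuousOn (hf.continuousOn (s := Set.Icc r t))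
  refine ⟨max C 0, hf.measurable.indicator measurableSet_Icc, fun z => ?_⟩
  by_cases hz : z ∈ Set.Icc r t
  · simpa [Set.indicator_of_mem hz] using Or.inl (hC z hz)
  · simp [Set.indicator_of_notMem hz]

lemma hasSum_clusterCumulant {a b t z : ℝ} (ha : 0 < a) (hab : a < b) (hz : z ∈ Set.Icc 0 t) :
    HasSum (fun m : ℕ => (hawkesGamma a b)^[m + 1]
      (Set.indicator (Set.Icc 0 t) fun z => clusterMean a b (t - z) ^ 2) z)
      (clusterCumulant a b (t - z)) := by
  have hK := continuous_clusterCumulant a b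
  have hM := continuous_clusterMean a b
  obtain ⟨C, hC⟩ := measurableBounded_indicator_Icc
    (f := fun z => clusterCumulant a b (t - z) + clusterMean a b (t - z) ^ 2) (by fun_prop) 0 t
  have h := hasSum_iterate_hawkesGamma hC ha hab z
  rw [hawkesGamma_indicator hab hz] at h
  refine h.congr_fun fun m => iterate_hawkesGamma_congr (r := 0) (fun w hw => ?_) (m + 1) hz.1
  by_cases hwt : w ≤ t
  · have hw' : w ∈ Set.Icc 0 t := ⟨hw, hwt⟩
    rw [Pi.sub_apply, hawkesGamma_indicator hab hw', Set.indicator_of_mem hw',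
      Set.indicator_of_mem hw', add_sub_cancel_left]
  · have hw' : w ∉ Set.Icc 0 t := fun h => hwt h.2
    rw [Pi.sub_apply, Set.indicator_of_notMem hw', Set.indicator_of_notMem hw', hawkesGamma,
      setIntegral_eq_zero_of_forall_eq_zero, mul_zero, sub_zero]
    intro y hy
    have hwy : w + y ∉ Set.Icc 0 t := fun h => by
      simp only [Set.mem_Ioi] at hy
      linarith [h.2]
    rw [Set.indicator_of_notMem hwy, zero_mul]

lemma integral_clusterCumulant_add {a b : ℝ} (hab : a < b) (t : ℝ) :
    ∫ s in (0 : ℝ)..t, (clusterCumulant a b s + clusterMean a b s ^ 2) =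
      -(1 / (2 * (a - b) ^ 4)) *
        (6 * a * b ^ 2 - a ^ 2 * b + 2 * b ^ 3 * (a - b) * t
          + 2 * a * (a ^ 2 - 3 * b ^ 2 + 2 * a * b * (a - b) * t) * Real.exp ((a - b) * t)
          + a ^ 2 * (b - 2 * a) * Real.exp (2 * (a - b) * t)) := by
  have hc : a - b ≠ 0 := (sub_neg.mpr hab).ne
  have hderiv : ∀ s ∈ Set.uIcc 0 t, HasDerivAt (fun s => -(1 / (2 * (a - b) ^ 4)) *
        (6 * a * b ^ 2 - a ^ 2 * b + 2 * b ^ 3 * (a - b) * s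
          + 2 * a * (a ^ 2 - 3 * b ^ 2 + 2 * a * b * (a - b) * s) * Real.exp ((a - b) * s)
          + a ^ 2 * (b - 2 * a) * Real.exp (2 * (a - b) * s)))
      (clusterCumulant a b s + clusterMean a b s ^ 2) s := by
    intro s _
    have h1 := hasDerivAt_exp_const_mul (a - b) s
    have h2 := hasDerivAt_exp_const_mul (2 * (a - b)) s
    have h3 := (((hasDerivAt_id s).const_mul (2 * b ^ 3 * (a - b))).const_add
      (6 * a * b ^ 2 - a ^ 2 * b))
    have h4 := ((((hasDerivAt_id s).const_mul (2 * a * b * (a - b))).const_add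
      (a ^ 2 - 3 * b ^ 2)).const_mul (2 * a)).mul h1
    have h := ((h3.add h4).add (h2.const_mul (a ^ 2 * (b - 2 * a)))).const_mul
      (-(1 / (2 * (a - b) ^ 4)))
    refine h.congr_deriv ?_
    have hE : Real.exp (2 * (a - b) * s) = Real.exp ((a - b) * s) ^ 2 := by
      rw [← Real.exp_nat_mul]
      congr 1
      push_cast
      ring
    have hba : b - a = -(a - b) := (neg_sub a b).symm
    simp only [clusterMean, clusterCumulant, id, hE, hba, neg_neg]
    generalize Real.exp ((a - b) * s) = E
    obtain ⟨c, rfl⟩ : ∃ c, a = b + c := ⟨a - b, by ring⟩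
    simp only [add_sub_cancel_left] at hc ⊢
    field_simp
    ring
  have hK := continuous_clusterCumulant a b
  have hM := continuous_clusterMean a b
  rw [intervalIntegral.integral_eq_sub_of_hasDerivAt hderiv
    (Continuous.intervalIntegrable (by fun_prop) _ _), sub_eq_self]
  simp
  right
  ring

/-- Variance of the Hawkes process with immigration rate `ν`:
`ν ∫₀^t (κ⁽²⁾(z) + (κ⁽¹⁾(z))²) dz
 = -(ν/(2(a-b)⁴)) (6ab² - a²b + 2b³(a-b)t + 2a(a² - 3b² + 2ab(a-b)t)e^{(a-b)t}
    + a²(b - 2a)e^{2(a-b)t})`. -/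
theorem hawkes_variance (a b t ν : ℝ) (ha : 0 < a) (hab : a < b) (ht : 0 < t) (hν : 0 < ν)
    (κ₁ κ₂ : ℝ → ℝ)
    (hκ₁ : κ₁ = Set.indicator (Set.Icc (0 : ℝ) t)
      (fun z => b / (b - a) - a / (b - a) * Real.exp (-(b - a) * (t - z))))
    (hκ₂ : ∀ z : ℝ, κ₂ z = ∑' m : ℕ, (hawkesGamma a b)^[m + 1] (fun w => (κ₁ w) ^ 2) z) :
    ν * ∫ z in (0 : ℝ)..t, (κ₂ z + (κ₁ z) ^ 2)
      = -(ν / (2 * (a - b) ^ 4)) *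
          (6 * a * b ^ 2 - a ^ 2 * b + 2 * b ^ 3 * (a - b) * t
            + 2 * a * (a ^ 2 - 3 * b ^ 2 + 2 * a * b * (a - b) * t) * Real.exp ((a - b) * t)
            + a ^ 2 * (b - 2 * a) * Real.exp (2 * (a - b) * t)) := by
  have hsq : (fun w => κ₁ w ^ 2) =
      Set.indicator (Set.Icc 0 t) fun z => clusterMean a b (t - z) ^ 2 := by
    funext w
    by_cases hw : w ∈ Set.Icc 0 t <;> simp [hκ₁, hw, clusterMean]
  have hint : ∫ z in (0 : ℝ)..t, (κ₂ z + κ₁ z ^ 2) =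
      ∫ z in (0 : ℝ)..t, (clusterCumulant a b (t - z) + clusterMean a b (t - z) ^ 2) := by
    refine intervalIntegral.integral_congr fun z hz => ?_
    rw [Set.uIcc_of_le ht.le] at hz
    have h1 : κ₁ z ^ 2 = clusterMean a b (t - z) ^ 2 := by
      rw [congrFun hsq z, Set.indicator_of_mem hz]
    simp only [hκ₂, hsq, (hasSum_clusterCumulant ha hab hz).tsum_eq, h1]
  rw [hint, intervalIntegral.integral_comp_sub_left
    (fun s => clusterCumulant a b s + clusterMean a b s ^ 2) t, sub_self, sub_zero,
    integral_clusterCumulant_add hab]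
  ring
end
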